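/- Every ℂ^{m×m}-valued PSD polynomial F that is not SOS has a non-constant Artin minimal denominator s ∈ ℝ[z₁, …, z_d]; moreover, every irreducible factor of such an s does not change sign on ℝ^d. -/

import Mathlib

open Matrix MvPolynomial
open scoped ComplexOrder

noncomputable section

/-- Conjugation of the coefficients of a polynomial; `eval z (conjPoly p) = conj (p(z̄))`. -/
def conjPoly {d : ℕ} (p : MvPolynomial (Fin d) ℂ) : MvPolynomial (Fin d) ℂ :=
  MvPolynomial.map (starRingEnd ℂ) p

/-- A real polynomial viewed as a complex one. -/
def toℂ {d : ℕ} (s : MvPolynomial (Fin d) ℝ) : MvPolynomial (Fin d) ℂ :=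
  MvPolynomial.map (algebraMap ℝ ℂ) s

/-- A `ℂ^{m×m}`-valued polynomial is PSD if its values at real points are positive
semidefinite Hermitian matrices. -/
def IsPSDPoly {d m : ℕ} (F : Matrix (Fin m) (Fin m) (MvPolynomial (Fin d) ℂ)) : Prop :=
  ∀ x : Fin d → ℝ, (Matrix.of fun i j => eval (fun t => (x t : ℂ)) (F i j)).PosSemidef

/-- A `ℂ^{m×m}`-valued polynomial is SOS if `F(z) = H(z)H(z̄)*` for some matrix
polynomial `H`. -/
def IsSOSPoly {d m : ℕ} (F : Matrix (Fin m) (Fin m) (MvPolynomial (Fin d) ℂ)) : Prop :=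
  ∃ (k : ℕ) (H : Matrix (Fin m) (Fin k) (MvPolynomial (Fin d) ℂ)),
    ∀ i j, F i j = ∑ l, H i l * conjPoly (H j l)

/-- `s` is an Artin denominator of `F`: `s ≠ 0` and `s²F` is SOS. -/
def IsArtinDen {d m : ℕ} (F : Matrix (Fin m) (Fin m) (MvPolynomial (Fin d) ℂ))
    (s : MvPolynomial (Fin d) ℝ) : Prop :=
  s ≠ 0 ∧ IsSOSPoly (Matrix.of fun i j => (toℂ s) ^ 2 * F i j)

/-- An ordered field has the polynomial intermediate value property if every polynomial that
changes sign between two points has a root strictly in between. -/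
def PolyIVT (R : Type*) [Field R] [LinearOrder R] : Prop :=
  ∀ (f : Polynomial R) (a b : R), a < b → f.eval a * f.eval b < 0 →
    ∃ c, a < c ∧ c < b ∧ f.eval c = 0

section OrderedField

variable {R : Type*} [Field R] [LinearOrder R] [IsStrictOrderedRing R]

lemma PolyIVT.mul_pos (hR : PolyIVT R) {f : Polynomial R} {a b : R} (hab : a ≤ b)
    (h : ∀ c, a ≤ c → c ≤ b → f.eval c ≠ 0) : 0 < f.eval a * f.eval b := by
  rcases hab.eq_or_lt with rfl | hlt
  · exact mul_self_pos.2 (h a le_rfl le_rfl)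
  by_contra hn
  have hne : f.eval a * f.eval b ≠ 0 := mul_ne_zero (h a le_rfl hab) (h b hab le_rfl)
  obtain ⟨c, h1, h2, h3⟩ := hR f a b hlt (lt_of_le_of_ne (not_lt.1 hn) hne)
  exact h c h1.le h2.le h3

/-- A weak form of Rolle's theorem: a polynomial whose derivative has no root in an interval
has at most one root there. -/
lemma PolyIVT.eq_of_root (hR : PolyIVT R) {f : Polynomial R} {l r a b : R}
    (hf : ∀ c, l < c → c < r → f.derivative.eval c ≠ 0)
    (hla : l < a) (hbr : b < r) (hab : a ≤ b) (ha : f.eval a = 0) (hb : f.eval b = 0) :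
    a = b := by
  by_contra hne
  have hlt : a < b := lt_of_le_of_ne hab hne
  have hf0 : f ≠ 0 := by
    rintro rfl
    exact hf a hla (hab.trans_lt hbr) (by simp)
  let S := f.roots.toFinset.filter fun c => a < c
  have hS : S.Nonempty := ⟨b, by simp [S, hf0, hb, hlt]⟩
  obtain ⟨b', hb'S, hmin⟩ := S.exists_min_image id hS
  have hb' : f.eval b' = 0 ∧ a < b' := by simpa [S, hf0] using hb'S
  have hb'b : b' ≤ b := hmin b (by simp [S, hf0, hb, hlt])
  have hgap : ∀ c, a < c → c < b' → f.eval c ≠ 0 := fun c h1 h2 h3 =>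
    absurd (hmin c (by simp [S, hf0, h3, h1])) (not_le.2 h2)
  obtain ⟨q1, hq1⟩ := Polynomial.dvd_iff_isRoot.2 ha
  have hq1b : q1.eval b' = 0 := by
    have := hb'.1
    rw [hq1] at this
    simpa [sub_ne_zero.2 hb'.2.ne'] using this
  obtain ⟨q, hq⟩ := Polynomial.dvd_iff_isRoot.2 hq1b
  rw [hq] at hq1
  have hda : f.derivative.eval a = (a - b') * q.eval a := by
    rw [hq1]; simp [Polynomial.derivative_mul]
  have hdb : f.derivative.eval b' = (b' - a) * q.eval b' := by
    rw [hq1]; simp [Polynomial.derivative_mul]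
  have hpos := hR.mul_pos hb'.2.le (fun c h1 h2 =>
    hf c (hla.trans_le h1) (h2.trans_lt (hb'b.trans_lt hbr)))
  rw [hda, hdb] at hpos
  have hneg : q.eval a * q.eval b' < 0 := by
    have h2 : 0 < (b' - a) ^ 2 := by have := sub_pos.2 hb'.2; positivity
    by_contra hcon
    nlinarith [mul_nonneg h2.le (not_lt.1 hcon)]
  obtain ⟨c, h1, h2, h3⟩ := hR q a b' hb'.2 hneg
  exact hgap c h1 h2 (by rw [hq1]; simp [h3])

lemma PolyIVT.mul_neg_of_root (hR : PolyIVT R) {f : Polynomial R} {l r z : R}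
    (hf : ∀ c, l < c → c < r → f.derivative.eval c ≠ 0) (hlz : l < z) (hzr : z < r)
    (hz : f.eval z = 0) (hl : f.eval l ≠ 0) (hr : f.eval r ≠ 0) : f.eval l * f.eval r < 0 := by
  obtain ⟨q, hq⟩ := Polynomial.dvd_iff_isRoot.2 hz
  have hdz : f.derivative.eval z = q.eval z := by
    rw [hq]; simp [Polynomial.derivative_mul]
  have hq0 : ∀ c, l ≤ c → c ≤ r → q.eval c ≠ 0 := by
    intro c h1 h2 h3
    have hfc : f.eval c = 0 := by rw [hq]; simp [h3]
    have h1 : l < c := lt_of_le_of_ne h1 (by rintro rfl; exact hl hfc)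
    have h2 : c < r := lt_of_le_of_ne h2 (by rintro rfl; exact hr hfc)
    have hcz : c = z := by
      rcases le_total c z with h | h
      · exact hR.eq_of_root hf h1 hzr h hfc hz
      · exact (hR.eq_of_root hf hlz h2 h hz hfc).symm
    rw [hcz, ← hdz] at h3
    exact hf z hlz hzr h3
  have := hR.mul_pos (hlz.trans hzr).le hq0
  rw [hq]
  simp only [Polynomial.eval_mul, Polynomial.eval_sub, Polynomial.eval_X, Polynomial.eval_C]
  have h2 : 0 < (z - l) * (r - z) := _root_.mul_pos (sub_pos.2 hlz) (sub_pos.2 hzr)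
  nlinarith [_root_.mul_pos h2 this]

end OrderedField

section RelativelyClosed

variable {E R : Type*} [Field E] [Field R] [LinearOrder R] [IsStrictOrderedRing R]

lemma exists_abs_lt_of_root (i : E →+* R) {f : Polynomial E} (hf : f.Monic) {z : R}
    (hz : f.eval₂ i z = 0) : ∃ M, |z| < i M := by
  refine ⟨1 + ∑ j ∈ Finset.range f.natDegree, (1 + f.coeff j ^ 2), ?_⟩
  set S := ∑ j ∈ Finset.range f.natDegree, (1 + i (f.coeff j) ^ 2) with hS
  have hi : i (1 + ∑ j ∈ Finset.range f.natDegree, (1 + f.coeff j ^ 2)) = 1 + S := by simp [hS]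
  rw [hi]
  have hS0 : 0 ≤ S := Finset.sum_nonneg fun j _ => by positivity
  rcases lt_or_ge |z| 1 with h1 | h1
  · linarith
  rw [Polynomial.eval₂_eq_sum_range, Finset.sum_range_succ, hf.coeff_natDegree, map_one,
    one_mul] at hz
  rcases Nat.eq_zero_or_pos f.natDegree with h0 | hpos
  · rw [h0] at hz; simp at hz
  have key : |z| ^ f.natDegree ≤ S * |z| ^ (f.natDegree - 1) := by
    rw [← abs_pow, eq_neg_of_add_eq_zero_right hz, abs_neg, hS, Finset.sum_mul]
    refine (Finset.abs_sum_le_sum_abs _ _).trans (Finset.sum_le_sum fun j hj => ?_)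
    rw [abs_mul, abs_pow]
    have hj' : j ≤ f.natDegree - 1 := by have := Finset.mem_range.1 hj; omega
    refine mul_le_mul ?_ (pow_le_pow_right₀ h1 hj') (by positivity) (by positivity)
    rw [abs_le]
    constructor <;> nlinarith [sq_nonneg (i (f.coeff j) - 1), sq_nonneg (i (f.coeff j) + 1)]
  obtain ⟨n, hn⟩ : ∃ n, f.natDegree = n + 1 := ⟨f.natDegree - 1, by omega⟩
  rw [hn, pow_succ', Nat.add_sub_cancel] at key
  have := le_of_mul_le_mul_right key (by positivity)
  linarith

/-- If all roots of `G` lie in the subfield `E`, then a point outside `E` that is bounded in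
terms of `E` lies in an interval with endpoints in `E` containing no root of `G`. -/
lemma exists_interval_avoiding_roots (i : E →+* R) {G : Polynomial E} (hG : G ≠ 0)
    (hroots : ∀ c, G.eval₂ i c = 0 → c ∈ Set.range i) {z : R} (hz : z ∉ Set.range i) {M : E}
    (hM : |z| < i M) :
    ∃ l r : E, i l < z ∧ z < i r ∧ ∀ c, i l < c → c < i r → G.eval₂ i c ≠ 0 := by
  have hG' : G.map i ≠ 0 := (Polynomial.map_ne_zero_iff i.injective).2 hG
  let S : Finset R := insert (i M) (insert (-i M) (G.map i).roots.toFinset)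
  have hSr : ∀ c ∈ S, c ∈ Set.range i := by
    intro c hc
    rcases Finset.mem_insert.1 hc with rfl | hc
    · exact ⟨M, rfl⟩
    rcases Finset.mem_insert.1 hc with rfl | hc
    · exact ⟨-M, map_neg i M⟩
    · exact hroots c (by simpa [hG, Polynomial.eval_map] using hc)
  have hmem : ∀ c, G.eval₂ i c = 0 → c ∈ S := fun c hc => by
    simp [S, hG, Polynomial.eval_map, hc]
  have hM' := abs_lt.1 hM
  obtain ⟨l, hl, hlmax⟩ := (S.filter (· < z)).exists_max_image id ⟨-i M, by simp [S, hM'.1]⟩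
  obtain ⟨r, hr, hrmin⟩ := (S.filter (z < ·)).exists_min_image id ⟨i M, by simp [S, hM'.2]⟩
  obtain ⟨hl1, hl2⟩ := Finset.mem_filter.1 hl
  obtain ⟨hr1, hr2⟩ := Finset.mem_filter.1 hr
  obtain ⟨l, rfl⟩ := hSr l hl1
  obtain ⟨r, rfl⟩ := hSr r hr1
  refine ⟨l, r, hl2, hr2, fun c h1 h2 h3 => ?_⟩
  rcases lt_trichotomy c z with h | h | h
  · exact absurd (hlmax c (Finset.mem_filter.2 ⟨hmem c h3, h⟩)) (not_le.2 h1)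
  · exact hz (h ▸ hroots c h3)
  · exact absurd (hrmin c (Finset.mem_filter.2 ⟨hmem c h3, h⟩)) (not_le.2 h2)

/-- If all roots of finitely many polynomials over `E` lie in `E`, their signs at any point are
the signs at some point of `E`. -/
lemma PolyIVT.exists_same_sign (hR : PolyIVT R) (i : E →+* R) (S : Finset (Polynomial E))
    (hroots : ∀ g ∈ S, g ≠ 0 → ∀ c, g.eval₂ i c = 0 → c ∈ Set.range i) (y : R) :
    ∃ e : E, ∀ g ∈ S, (0 < g.eval₂ i (i e) ↔ 0 < g.eval₂ i y) := by
  by_cases hy : y ∈ Set.range i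
  · obtain ⟨e, rfl⟩ := hy
    exact ⟨e, fun _ _ => Iff.rfl⟩
  let Z : Finset R := S.biUnion fun g => (g.map i).roots.toFinset
  have hZ : ∀ c, c ∈ Z ↔ ∃ g ∈ S, g ≠ 0 ∧ g.eval₂ i c = 0 := by
    intro c
    simp [Z, Polynomial.eval_map]
  have hZr : ∀ c ∈ Z, c ∈ Set.range i := fun c hc => by
    obtain ⟨g, h1, h2, h3⟩ := (hZ c).1 hc
    exact hroots g h1 h2 c h3
  have hyZ : y ∉ Z := fun h => hy (hZr y h)
  suffices h : ∃ e : E, ∀ c ∈ Z, (i e < c ↔ y < c) ∧ i e ≠ c by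
    obtain ⟨e, he⟩ := h
    refine ⟨e, fun g hg => ?_⟩
    by_cases hg0 : g = 0
    · simp [hg0]
    have hno : ∀ c, (i e ≤ c ∧ c ≤ y ∨ y ≤ c ∧ c ≤ i e) → (g.map i).eval c ≠ 0 := by
      intro c hc h0
      have hcZ : c ∈ Z := (hZ c).2 ⟨g, hg, hg0, by rwa [← Polynomial.eval_map]⟩
      obtain ⟨h1, h2⟩ := he c hcZ
      have h3 : y ≠ c := fun h => hyZ (h ▸ hcZ)
      rcases hc with ⟨h4, h5⟩ | ⟨h4, h5⟩
      · exact absurd (h1.1 (lt_of_le_of_ne h4 h2)) (not_lt.2 h5)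
      · exact absurd (h1.2 (lt_of_le_of_ne h4 h3)) (not_lt.2 h5)
    rw [← Polynomial.eval_map, ← Polynomial.eval_map]
    rcases le_total (i e) y with h | h
    · exact pos_iff_pos_of_mul_pos (hR.mul_pos h fun c h1 h2 => hno c (.inl ⟨h1, h2⟩))
    · exact (pos_iff_pos_of_mul_pos (hR.mul_pos h fun c h1 h2 => hno c (.inr ⟨h1, h2⟩))).symm
  rcases (Z.filter (· < y)).eq_empty_or_nonempty with hL | hL
  · rcases Z.eq_empty_or_nonempty with hU | hU
    · exact ⟨0, by simp [hU]⟩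
    · obtain ⟨r, hr, hrmin⟩ := Z.exists_min_image id hU
      obtain ⟨r, rfl⟩ := hZr r hr
      refine ⟨r - 1, fun c hc => ?_⟩
      have h1 : i r ≤ c := hrmin c hc
      have h2 : i (r - 1) < c := by simp only [map_sub, map_one]; linarith
      have h3 : ¬ c < y := fun h => by
        have : c ∈ Z.filter (· < y) := Finset.mem_filter.2 ⟨hc, h⟩
        simp [hL] at this
      have h4 : y < c := lt_of_le_of_ne (not_lt.1 h3) (fun h => hyZ (h ▸ hc))
      exact ⟨iff_of_true h2 h4, h2.ne⟩
  · obtain ⟨l, hl, hlmax⟩ := (Z.filter (· < y)).exists_max_image id hL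
    obtain ⟨hl1, hl2⟩ := Finset.mem_filter.1 hl
    obtain ⟨l, rfl⟩ := hZr l hl1
    rcases (Z.filter (y < ·)).eq_empty_or_nonempty with hU | hU
    · refine ⟨l + 1, fun c hc => ?_⟩
      have h3 : ¬ y < c := fun h => by
        have : c ∈ Z.filter (y < ·) := Finset.mem_filter.2 ⟨hc, h⟩
        simp [hU] at this
      have h4 : c < y := lt_of_le_of_ne (not_lt.1 h3) (fun h => hyZ (h ▸ hc))
      have h1 : c ≤ i l := hlmax c (Finset.mem_filter.2 ⟨hc, h4⟩)
      have h2 : c < i (l + 1) := by simp only [map_add, map_one]; linarith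
      exact ⟨iff_of_false h2.not_gt h4.not_gt, h2.ne'⟩
    · obtain ⟨r, hr, hrmin⟩ := (Z.filter (y < ·)).exists_min_image id hU
      obtain ⟨hr1, hr2⟩ := Finset.mem_filter.1 hr
      obtain ⟨r, rfl⟩ := hZr r hr1
      have hlr : i l < i r := hl2.trans hr2
      have hmid : i ((l + r) / 2) = (i l + i r) / 2 := by rw [map_div₀, map_add, map_ofNat]
      refine ⟨(l + r) / 2, fun c hc => ?_⟩
      rw [hmid]
      rcases lt_trichotomy c y with h | h | h
      · have h1 : c ≤ i l := hlmax c (Finset.mem_filter.2 ⟨hc, h⟩)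
        have h2 : c < (i l + i r) / 2 := by linarith
        exact ⟨iff_of_false h2.not_gt h.not_gt, h2.ne'⟩
      · exact absurd (h ▸ hc) hyZ
      · have h1 : i r ≤ c := hrmin c (Finset.mem_filter.2 ⟨hc, h⟩)
        have h2 : (i l + i r) / 2 < c := by linarith
        exact ⟨iff_of_true h2 h, h2.ne⟩

end RelativelyClosed

section Extension

lemma exists_irreducible_of_root {E R : Type*} [Field E] [Field R] (i : E →+* R)
    {g : Polynomial E} (hg : g ≠ 0) {w : R} (hw : g.eval₂ i w = 0) :
    ∃ f : Polynomial E, Irreducible f ∧ f.Monic ∧ f.eval₂ i w = 0 ∧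
      f.natDegree ≤ g.natDegree := by
  let _ := i.toAlgebra
  have hw_int : IsIntegral E w := isAlgebraic_iff_isIntegral.1 ⟨g, hg, hw⟩
  exact ⟨minpoly E w, minpoly.irreducible hw_int, minpoly.monic hw_int, minpoly.aeval E w,
    Polynomial.natDegree_le_of_dvd (minpoly.dvd E w hw) hg⟩

lemma eval_ne_zero_of_root_notMem {E R : Type*} [Field E] [Field R] (i : E →+* R)
    {f : Polynomial E} (hf : Irreducible f) {z : R} (hz : f.eval₂ i z = 0)
    (hzr : z ∉ Set.range i) (e : E) : f.eval e ≠ 0 := by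
  intro h
  obtain ⟨q, hq⟩ := Polynomial.dvd_iff_isRoot.2 h
  rcases hf.isUnit_or_isUnit hq with hu | hu
  · exact Polynomial.not_isUnit_X_sub_C e hu
  · obtain ⟨c, hc, rfl⟩ := Polynomial.isUnit_iff.1 hu
    rw [hq] at hz
    simp only [Polynomial.eval₂_mul, Polynomial.eval₂_sub, Polynomial.eval₂_X,
      Polynomial.eval₂_C, mul_eq_zero, map_eq_zero, hc.ne_zero, or_false] at hz
    exact hzr ⟨e, (sub_eq_zero.1 hz).symm⟩

lemma sign_eq_midpoint {E R : Type*} [Field E] [CharZero E] [Field R] [LinearOrder R]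
    [IsStrictOrderedRing R] (hR : PolyIVT R) (i : E →+* R) {g : Polynomial E} {l r : E}
    (hno : ∀ c, i l < c → c < i r → g.eval₂ i c ≠ 0) {z : R} (hl : i l < z) (hr : z < i r) :
    0 < g.eval₂ i z ↔ 0 < i (g.eval ((l + r) / 2)) := by
  have hmid : i ((l + r) / 2) = (i l + i r) / 2 := by rw [map_div₀, map_add, map_ofNat]
  have h1 : i l < i ((l + r) / 2) := by rw [hmid]; linarith
  have h2 : i ((l + r) / 2) < i r := by rw [hmid]; linarith
  rw [← Polynomial.eval₂_at_apply, ← Polynomial.eval_map, ← Polynomial.eval_map]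
  simp_rw [← Polynomial.eval_map] at hno
  rcases le_total z (i ((l + r) / 2)) with h | h
  · exact pos_iff_pos_of_mul_pos (hR.mul_pos h fun c h3 h4 =>
      hno c (hl.trans_le h3) (h4.trans_lt h2))
  · exact (pos_iff_pos_of_mul_pos (hR.mul_pos h fun c h3 h4 =>
      hno c (h1.trans_le h3) (h4.trans_lt hr))).symm

lemma exists_isolating_interval {E R : Type*} [Field E] [Field R] [LinearOrder R]
    [IsStrictOrderedRing R] (hR : PolyIVT R) (i : E →+* R) {f : Polynomial E}
    (hf : Irreducible f) (hmon : f.Monic) {z : R} (hz : f.eval₂ i z = 0)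
    (hzr : z ∉ Set.range i)
    (hlow : ∀ g : Polynomial E, g ≠ 0 → g.natDegree < f.natDegree →
      ∀ c, g.eval₂ i c = 0 → c ∈ Set.range i)
    {G : Polynomial E} (hG : G ≠ 0) (hGr : ∀ c, G.eval₂ i c = 0 → c ∈ Set.range i) :
    ∃ l r : E, i l < z ∧ z < i r ∧ i (f.eval l * f.eval r) < 0 ∧
      ∀ c, i l < c → c < i r → G.eval₂ i c ≠ 0 := by
  have : CharZero E := i.charZero
  have hpos : 0 < f.natDegree := hf.natDegree_pos
  have hlt : f.derivative.natDegree < f.natDegree :=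
    Polynomial.natDegree_derivative_lt hpos.ne'
  have hd : f.derivative ≠ 0 := fun h => by
    have := Polynomial.derivative_eq_zero.1 h
    omega
  obtain ⟨M, hM⟩ := exists_abs_lt_of_root i hmon hz
  obtain ⟨l, r, hl, hr, hno⟩ := exists_interval_avoiding_roots i (mul_ne_zero hG hd)
    (fun c hc => by
      rw [Polynomial.eval₂_mul, mul_eq_zero] at hc
      exact hc.elim (hGr c) (hlow _ hd hlt c)) hzr hM
  refine ⟨l, r, hl, hr, ?_,
    fun c h1 h2 h3 => hno c h1 h2 (by rw [Polynomial.eval₂_mul, h3, zero_mul])⟩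
  have he : ∀ e : E, (f.map i).eval (i e) = i (f.eval e) := fun e => by
    rw [Polynomial.eval_map, Polynomial.eval₂_at_apply]
  have hne : ∀ e : E, (f.map i).eval (i e) ≠ 0 := fun e => by
    rw [he]
    exact (map_ne_zero i).2 (eval_ne_zero_of_root_notMem i hf hz hzr e)
  have := hR.mul_neg_of_root (f := f.map i) (l := i l) (r := i r) (z := z)
    (fun c h1 h2 h3 => hno c h1 h2 (by
      rw [Polynomial.derivative_map, Polynomial.eval_map] at h3
      rw [Polynomial.eval₂_mul, h3, mul_zero])) hl hr (by rwa [Polynomial.eval_map])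
    (hne l) (hne r)
  rwa [he, he, ← map_mul] at this

variable {E R₁ R₂ : Type*} [Field E] [Field R₁] [LinearOrder R₁] [IsStrictOrderedRing R₁]
  [Field R₂] [LinearOrder R₂] [IsStrictOrderedRing R₂]

lemma neg_iff_neg_of_same_sign {i₁ : E →+* R₁} {i₂ : E →+* R₂}
    (hs : ∀ e, 0 < i₁ e ↔ 0 < i₂ e) (e : E) : i₁ e < 0 ↔ i₂ e < 0 := by
  simpa using hs (-e)

lemma lt_iff_lt_of_same_sign {i₁ : E →+* R₁} {i₂ : E →+* R₂}
    (hs : ∀ e, 0 < i₁ e ↔ 0 < i₂ e) (a b : E) : i₁ a < i₁ b ↔ i₂ a < i₂ b := by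
  simpa using hs (b - a)

lemma exists_root_of_sign_change (h₁ : PolyIVT R₁) (i₁ : E →+* R₁) {f : Polynomial E} {l r : E}
    (hlr : i₁ l < i₁ r) (hneg : i₁ (f.eval l * f.eval r) < 0) :
    ∃ c, i₁ l < c ∧ c < i₁ r ∧ f.eval₂ i₁ c = 0 := by
  obtain ⟨c, h1, h2, h3⟩ := h₁ (f.map i₁) (i₁ l) (i₁ r) hlr (by
    rw [Polynomial.eval_map, Polynomial.eval₂_at_apply, Polynomial.eval_map,
      Polynomial.eval₂_at_apply, ← map_mul]
    exact hneg)
  exact ⟨c, h1, h2, by rwa [← Polynomial.eval_map]⟩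

lemma roots_mem_range_transfer (h₁ : PolyIVT R₁) (h₂ : PolyIVT R₂) {i₁ : E →+* R₁}
    {i₂ : E →+* R₂} (hs : ∀ e, 0 < i₁ e ↔ 0 < i₂ e) {n : ℕ}
    (hlow : ∀ g : Polynomial E, g ≠ 0 → g.natDegree < n →
      ∀ c, g.eval₂ i₁ c = 0 → c ∈ Set.range i₁) :
    ∀ g : Polynomial E, g ≠ 0 → g.natDegree < n →
      ∀ c, g.eval₂ i₂ c = 0 → c ∈ Set.range i₂ := by
  suffices H : ∀ k, ∀ g : Polynomial E, g ≠ 0 → g.natDegree = k → g.natDegree < n →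
      ∀ c, g.eval₂ i₂ c = 0 → c ∈ Set.range i₂ from fun g hg hn => H _ g hg rfl hn
  intro k
  induction k using Nat.strong_induction_on with
  | _ k ih =>
  intro g hg hk hn w hw
  by_contra hwr
  obtain ⟨f, hf, hmon, hfw, hle⟩ := exists_irreducible_of_root i₂ hg hw
  obtain ⟨l, r, hl, hr, hneg, -⟩ := exists_isolating_interval h₂ i₂ hf hmon hfw hwr
    (fun g' hg' hlt => ih g'.natDegree (by omega) g' hg' rfl (by omega))
    (one_ne_zero) (by simp)
  obtain ⟨c, -, -, hc⟩ := exists_root_of_sign_change h₁ i₁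
    ((lt_iff_lt_of_same_sign hs l r).2 (hl.trans hr))
    ((neg_iff_neg_of_same_sign hs _).2 hneg)
  obtain ⟨e, rfl⟩ := hlow f hf.ne_zero (by omega) c hc
  rw [Polynomial.eval₂_at_apply, map_eq_zero] at hc
  exact eval_ne_zero_of_root_notMem i₂ hf hfw hwr e hc

/-- Over a field with compatible embeddings into two ordered fields with the intermediate value
property, an order-preserving simple algebraic extension step is always possible. -/
lemma exists_same_sign_extension (h₁ : PolyIVT R₁) (h₂ : PolyIVT R₂) {i₁ : E →+* R₁}
    {i₂ : E →+* R₂} (hs : ∀ e, 0 < i₁ e ↔ 0 < i₂ e) {g₀ : Polynomial E} (hg₀ : g₀ ≠ 0) {z₀ : R₁}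
    (hz₀ : g₀.eval₂ i₁ z₀ = 0) (hz₀r : z₀ ∉ Set.range i₁) :
    ∃ z ∉ Set.range i₁, ∃ w : R₂, ∀ g : Polynomial E, 0 < g.eval₂ i₁ z ↔ 0 < g.eval₂ i₂ w := by
  classical
  have hex : ∃ n, ∃ g : Polynomial E, g ≠ 0 ∧ g.natDegree = n ∧
      ∃ z ∉ Set.range i₁, g.eval₂ i₁ z = 0 := ⟨_, g₀, hg₀, rfl, z₀, hz₀r, hz₀⟩
  obtain ⟨g₁, hg₁, hg₁n, z, hzr, hz⟩ := Nat.find_spec hex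
  obtain ⟨f, hf, hmon, hfz, hle⟩ := exists_irreducible_of_root i₁ hg₁ hz
  have hlow : ∀ g : Polynomial E, g ≠ 0 → g.natDegree < f.natDegree →
      ∀ c, g.eval₂ i₁ c = 0 → c ∈ Set.range i₁ := by
    intro g hg hlt c hc
    by_contra hcr
    exact Nat.find_min hex (m := g.natDegree) (by omega) ⟨g, hg, rfl, c, hcr, hc⟩
  have hlow₂ := roots_mem_range_transfer h₁ h₂ hs hlow
  refine ⟨z, hzr, ?_⟩
  by_contra hcon
  have hcon' : ∀ w : R₂, ∃ g : Polynomial E, ¬ (0 < g.eval₂ i₁ z ↔ 0 < g.eval₂ i₂ w) :=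
    fun w => by_contra fun h => hcon ⟨w, fun g => by_contra fun h' => h ⟨g, h'⟩⟩
  choose B hB using hcon'
  have hmap : f.map i₂ ≠ 0 := (hmon.map i₂).ne_zero
  have hroot : ∀ w, w ∈ (f.map i₂).roots.toFinset ↔ f.eval₂ i₂ w = 0 := fun w => by
    simp [hmon.ne_zero, Polynomial.eval_map]
  have hB' : ∀ w, f.eval₂ i₂ w = 0 →
      ¬ (0 < (B w %ₘ f).eval₂ i₁ z ↔ 0 < (B w %ₘ f).eval₂ i₂ w) := fun w hw => by
    rw [Polynomial.eval₂_modByMonic_eq_self_of_root hfz,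
      Polynomial.eval₂_modByMonic_eq_self_of_root hw]
    exact hB w
  have hB0 : ∀ w, f.eval₂ i₂ w = 0 → B w %ₘ f ≠ 0 := fun w hw h => hB' w hw (by simp [h])
  have hBdeg : ∀ w, (B w %ₘ f).natDegree < f.natDegree := fun w =>
    Polynomial.natDegree_modByMonic_lt _ hmon (fun h => hf.not_isUnit (h ▸ isUnit_one))
  obtain ⟨l, r, hl, hr, hneg, hno⟩ := exists_isolating_interval h₁ i₁ hf hmon hfz hzr hlow
    (G := ∏ w ∈ (f.map i₂).roots.toFinset, (B w %ₘ f))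
    (Finset.prod_ne_zero_iff.2 fun w hw => hB0 w ((hroot w).1 hw))
    (fun c hc => by
      rw [Polynomial.eval₂_finsetProd, Finset.prod_eq_zero_iff] at hc
      obtain ⟨w, hw, hc⟩ := hc
      exact hlow _ (hB0 w ((hroot w).1 hw)) (hBdeg w) c hc)
  have hlr := hl.trans hr
  have hlr₂ := (lt_iff_lt_of_same_sign hs l r).1 hlr
  obtain ⟨w, hw1, hw2, hw⟩ := exists_root_of_sign_change h₂ i₂ hlr₂
    ((neg_iff_neg_of_same_sign hs _).1 hneg)
  set g := B w %ₘ f with hg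
  have hno₁ : ∀ c, i₁ l < c → c < i₁ r → g.eval₂ i₁ c ≠ 0 := fun c h1 h2 h3 => by
    refine hno c h1 h2 ?_
    rw [Polynomial.eval₂_finsetProd]
    exact Finset.prod_eq_zero ((hroot w).2 hw) h3
  have hno₂ : ∀ c, i₂ l < c → c < i₂ r → g.eval₂ i₂ c ≠ 0 := fun c h1 h2 h3 => by
    obtain ⟨e, rfl⟩ := hlow₂ g (hB0 w hw) (hBdeg w) c h3
    rw [Polynomial.eval₂_at_apply, map_eq_zero] at h3
    refine hno₁ (i₁ e) ((lt_iff_lt_of_same_sign hs _ _).2 h1)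
      ((lt_iff_lt_of_same_sign hs _ _).2 h2) ?_
    rw [Polynomial.eval₂_at_apply, h3, map_zero]
  have : CharZero E := i₁.charZero
  have e1 := sign_eq_midpoint h₁ i₁ hno₁ hl hr
  have e2 := sign_eq_midpoint h₂ i₂ hno₂ hw1 hw2
  exact hB' w hw (e1.trans ((hs _).trans e2.symm))

end Extension

section Transfer

variable {R₁ R₂ : Type*} [Field R₁] [LinearOrder R₁] [IsStrictOrderedRing R₁]
  [Field R₂] [LinearOrder R₂] [IsStrictOrderedRing R₂]

/-- A subring of a product of two ordered fields is sign compatible if the two coordinates of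
each element have the same sign. -/
def SignCompatible (G : Subring (R₁ × R₂)) : Prop := ∀ x ∈ G, 0 < x.1 ↔ 0 < x.2

lemma exists_maximal_signCompatible {G₀ : Subring (R₁ × R₂)} (h₀ : SignCompatible G₀) :
    ∃ G, G₀ ≤ G ∧ Maximal SignCompatible G := by
  refine zorn_le_nonempty₀ {G | SignCompatible G} (fun c hc hchain y hy => ?_) G₀ h₀
  refine ⟨sSup c, fun x hx => ?_, fun z hz => le_sSup hz⟩
  obtain ⟨G, hG, hxG⟩ := (Subring.mem_sSup_of_directedOn ⟨y, hy⟩ hchain.directedOn).1 hx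
  exact hc hG x hxG

lemma SignCompatible.eq_zero {G : Subring (R₁ × R₂)} (hG : SignCompatible G) {x : R₁ × R₂}
    (hx : x ∈ G) : x.1 = 0 ↔ x.2 = 0 := by
  have h1 := hG x hx
  have h2 := hG (-x) (neg_mem hx)
  simp only [Prod.fst_neg, Prod.snd_neg, Left.neg_pos_iff] at h2
  constructor
  · intro h
    rw [h] at h1 h2
    exact le_antisymm (not_lt.1 (fun h' => (lt_irrefl _ (h1.2 h'))))
      (not_lt.1 (fun h' => (lt_irrefl _ (h2.2 h'))))
  · intro h
    rw [h] at h1 h2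
    exact le_antisymm (not_lt.1 (fun h' => (lt_irrefl _ (h1.1 h'))))
      (not_lt.1 (fun h' => (lt_irrefl _ (h2.1 h'))))

lemma isField_of_maximal_signCompatible {G : Subring (R₁ × R₂)}
    (hG : Maximal SignCompatible G) : IsField G := by
  let G' : Subring (R₁ × R₂) :=
    { carrier := {p | ∃ a ∈ G, ∃ b ∈ G, 0 < b.1 ∧ p * b = a}
      mul_mem' := by
        rintro p q ⟨a, ha, b, hb, hb0, rfl⟩ ⟨a', ha', b', hb', hb0', rfl⟩
        exact ⟨_, mul_mem ha ha', _, mul_mem hb hb', mul_pos hb0 hb0', by ring⟩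
      one_mem' := ⟨1, one_mem G, 1, one_mem G, by simp, by simp⟩
      add_mem' := by
        rintro p q ⟨a, ha, b, hb, hb0, rfl⟩ ⟨a', ha', b', hb', hb0', rfl⟩
        exact ⟨_, add_mem (mul_mem ha hb') (mul_mem ha' hb), _, mul_mem hb hb', mul_pos hb0 hb0',
          by ring⟩
      zero_mem' := ⟨0, zero_mem G, 1, one_mem G, by simp, by simp⟩
      neg_mem' := by
        rintro p ⟨a, ha, b, hb, hb0, rfl⟩
        exact ⟨_, neg_mem ha, b, hb, hb0, by ring⟩ }
  have hG' : SignCompatible G' := by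
    rintro p ⟨a, ha, b, hb, hb0, rfl⟩
    have h := hG.prop _ ha
    have hb2 := (hG.prop _ hb).1 hb0
    simpa [Prod.fst_mul, Prod.snd_mul, mul_pos_iff_of_pos_right, hb0, hb2] using h
  have hle : G' ≤ G := hG.le_of_ge hG' fun x hx => ⟨x, hx, 1, one_mem G, by simp, by simp⟩
  refine ⟨⟨0, 1, zero_ne_one⟩, mul_comm, fun {x} hx => ?_⟩
  have hx1 : x.1.1 ≠ 0 := fun h => hx (Subtype.ext (Prod.ext h ((hG.prop.eq_zero x.2).1 h)))
  have hx2 : x.1.2 ≠ 0 := fun h => hx1 ((hG.prop.eq_zero x.2).2 h)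
  refine ⟨⟨(x.1.1⁻¹, x.1.2⁻¹), hle ⟨x.1, x.2, x.1 * x.1, mul_mem x.2 x.2, ?_, ?_⟩⟩, ?_⟩
  · exact mul_self_pos.2 hx1
  · ext <;> simp [hx1, hx2]
  · ext <;> simp [hx1, hx2]

/-- Simultaneous strict sign conditions in one variable over a subring with compatible orders can
be transferred between ordered fields with the intermediate value property. -/
theorem exists_same_sign_transfer (h₁ : PolyIVT R₁) (h₂ : PolyIVT R₂) {A : Type*} [CommRing A]
    {φ : A →+* R₁} {ψ : A →+* R₂} (hs : ∀ a, 0 < φ a ↔ 0 < ψ a)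
    (S : Finset (Polynomial A)) (y : R₁) :
    ∃ w : R₂, ∀ g ∈ S, 0 < g.eval₂ φ y ↔ 0 < g.eval₂ ψ w := by
  classical
  obtain ⟨G, hle, hG⟩ := exists_maximal_signCompatible (G₀ := (φ.prod ψ).range) (by
    rintro _ ⟨a, rfl⟩
    exact hs a)
  obtain ⟨E, _, e, -⟩ : ∃ (E : Type _) (_ : Field E) (_ : E ≃+* G), True :=
    ⟨G, (isField_of_maximal_signCompatible hG).toField, RingEquiv.refl _, trivial⟩
  let i₁ : E →+* R₁ := ((RingHom.fst R₁ R₂).comp G.subtype).comp e.toRingHom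
  let i₂ : E →+* R₂ := ((RingHom.snd R₁ R₂).comp G.subtype).comp e.toRingHom
  have hi : ∀ x, 0 < i₁ x ↔ 0 < i₂ x := fun x => hG.prop _ (e x).2
  let j : A →+* E := e.symm.toRingHom.comp
    ((φ.prod ψ).codRestrict G fun a => hle ⟨a, rfl⟩)
  have hj₁ : i₁.comp j = φ := by ext a; simp [i₁, j]
  have hj₂ : i₂.comp j = ψ := by ext a; simp [i₂, j]
  have hclosed : ∀ g : Polynomial E, g ≠ 0 → ∀ c, g.eval₂ i₁ c = 0 → c ∈ Set.range i₁ := by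
    intro g hg c hc
    by_contra hcr
    obtain ⟨z, hz, w, hzw⟩ := exists_same_sign_extension h₁ h₂ hi hg hc hcr
    let ev : Polynomial E →+* R₁ × R₂ :=
      (Polynomial.eval₂RingHom i₁ z).prod (Polynomial.eval₂RingHom i₂ w)
    have hcomp : SignCompatible ev.range := by
      rintro _ ⟨q, rfl⟩
      exact hzw q
    have hGle : G ≤ ev.range := fun x hx =>
      ⟨Polynomial.C (e.symm ⟨x, hx⟩), by ext <;> simp [ev, i₁, i₂]⟩
    have hmem : (z, w) ∈ G := hG.le_of_ge hcomp hGle ⟨Polynomial.X, by ext <;> simp [ev]⟩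
    exact hz ⟨e.symm ⟨_, hmem⟩, by simp [i₁]⟩
  obtain ⟨x, hx⟩ := h₁.exists_same_sign i₁ (S.image (Polynomial.map j))
    (fun g _ hg => hclosed g hg) y
  refine ⟨i₂ x, fun g hg => ?_⟩
  have h := hx _ (Finset.mem_image_of_mem _ hg)
  rw [Polynomial.eval₂_at_apply, hi, ← Polynomial.eval₂_at_apply, Polynomial.eval₂_map,
    Polynomial.eval₂_map, hj₁, hj₂] at h
  exact h.symm

end Transfer

section Ultrapower

variable {I : Type*} (𝒰 : Ultrafilter I)

lemma polyIVT_real : PolyIVT ℝ := by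
  intro f a b hab hneg
  have hc : ContinuousOn (fun x => f.eval x) (Set.Icc a b) := f.continuous.continuousOn
  rcases mul_neg_iff.1 hneg with ⟨ha, hb⟩ | ⟨ha, hb⟩
  · obtain ⟨c, hc, h⟩ := intermediate_value_Ioo' hab.le hc ⟨hb, ha⟩
    exact ⟨c, hc.1, hc.2, h⟩
  · obtain ⟨c, hc, h⟩ := intermediate_value_Ioo hab.le hc ⟨ha, hb⟩
    exact ⟨c, hc.1, hc.2, h⟩

/-- The quotient map from functions to an ultrapower. -/
abbrev germHom : (I → ℝ) →+* Filter.Germ (𝒰 : Filter I) ℝ := Filter.Germ.coeRingHom _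

lemma germHom_pos {u : I → ℝ} : 0 < germHom 𝒰 u ↔ ∀ᶠ s in (𝒰 : Filter I), 0 < u s :=
  Filter.Germ.coe_pos

lemma eval_germHom (p : Polynomial (I → ℝ)) (u : I → ℝ) :
    (p.map (germHom 𝒰)).eval (germHom 𝒰 u) =
      germHom 𝒰 fun s => (p.map (Pi.evalRingHom (fun _ => ℝ) s)).eval (u s) := by
  rw [Polynomial.eval_map, Polynomial.eval₂_at_apply]
  congr 1
  ext s
  rw [Polynomial.eval_map, show u s = Pi.evalRingHom (fun _ => ℝ) s u from rfl,
    Polynomial.eval₂_at_apply]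
  rfl

lemma polyIVT_germ : PolyIVT (Filter.Germ (𝒰 : Filter I) ℝ) := by
  intro f a b hab hneg
  obtain ⟨p, rfl⟩ := Polynomial.map_surjective (germHom 𝒰) (Quotient.mk''_surjective) f
  obtain ⟨a, rfl⟩ : ∃ u, germHom 𝒰 u = a := Quotient.mk''_surjective a
  obtain ⟨b, rfl⟩ : ∃ u, germHom 𝒰 u = b := Quotient.mk''_surjective b
  rw [← sub_pos, ← map_sub, germHom_pos] at hab
  rw [eval_germHom, eval_germHom, ← map_mul, ← neg_pos, ← map_neg, germHom_pos] at hneg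
  have hex : ∀ᶠ s in (𝒰 : Filter I), ∃ c, a s < c ∧ c < b s ∧
      (p.map (Pi.evalRingHom (fun _ => ℝ) s)).eval c = 0 := by
    filter_upwards [hab, hneg] with s h1 h2
    exact polyIVT_real _ _ _ (sub_pos.1 h1) (neg_pos.1 h2)
  classical
  choose! c hc using fun s (h : ∃ c, a s < c ∧ c < b s ∧
      (p.map (Pi.evalRingHom (fun _ => ℝ) s)).eval c = 0) => h
  refine ⟨germHom 𝒰 c, ?_, ?_, ?_⟩
  · rw [← sub_pos, ← map_sub, germHom_pos]
    filter_upwards [hex] with s h using sub_pos.2 (hc s h).1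
  · rw [← sub_pos, ← map_sub, germHom_pos]
    filter_upwards [hex] with s h using sub_pos.2 (hc s h).2.1
  · rw [eval_germHom, ← map_zero (germHom 𝒰)]
    refine Filter.Germ.coe_eq.2 ?_
    filter_upwards [hex] with s h using (hc s h).2.2

end Ultrapower

section ArtinLang

lemma eval₂_finSuccEquiv {d : ℕ} {R : Type*} [CommRing R] (φ : MvPolynomial (Fin d) ℝ →+* R)
    (y : R) (f : MvPolynomial (Fin (d + 1)) ℝ) :
    (finSuccEquiv ℝ d f).eval₂ φ y =
      eval₂ (φ.comp C) (Fin.cons y fun j => φ (X j)) f := by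
  have : (Polynomial.eval₂RingHom φ y).comp (finSuccEquiv ℝ d : _ →+* _) =
      eval₂Hom (φ.comp C) (Fin.cons y fun j => φ (X j)) := by
    refine MvPolynomial.ringHom_ext (fun r => ?_) (fun i => ?_)
    · simp [finSuccEquiv_apply]
    · refine Fin.cases ?_ (fun j => ?_) i
      · simp [finSuccEquiv_X_zero]
      · simp [finSuccEquiv_X_succ]
  exact congrArg (fun g => g f) this

variable {Ω : Type*} [Field Ω] [LinearOrder Ω] [IsStrictOrderedRing Ω]

lemma pos_ringHom_real_iff (ι : ℝ →+* Ω) (c : ℝ) : 0 < ι c ↔ 0 < c := by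
  have key : ∀ c, 0 < c → 0 < ι c := fun c hc => by
    rw [← Real.mul_self_sqrt hc.le, map_mul]
    exact mul_self_pos.2 ((map_ne_zero ι).2 (Real.sqrt_pos.2 hc).ne')
  refine ⟨fun h => ?_, key c⟩
  by_contra hn
  rcases (not_lt.1 hn).eq_or_lt with rfl | hlt
  · simp at h
  · have := key (-c) (neg_pos.2 hlt)
    rw [map_neg] at this
    linarith

/-- A form of the Artin-Lang theorem: strict sign conditions satisfied by a point over an ordered
extension of the reals with the intermediate value property are satisfied by a real point. -/
theorem exists_real_point_same_sign (hΩ : PolyIVT Ω) (ι : ℝ →+* Ω) : ∀ {d : ℕ} (ξ : Fin d → Ω)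
    (S : Finset (MvPolynomial (Fin d) ℝ)),
    ∃ a : Fin d → ℝ, ∀ f ∈ S, 0 < eval₂ ι ξ f ↔ 0 < eval a f := by
  classical
  intro d
  induction d with
  | zero =>
    intro ξ S
    refine ⟨Fin.elim0, fun f _ => ?_⟩
    rw [MvPolynomial.eq_C_of_isEmpty f]
    simp [pos_ringHom_real_iff]
  | succ d ih =>
    intro ξ S
    choose a ha using ih (Fin.tail ξ)
    let 𝒰 : Ultrafilter (Finset (MvPolynomial (Fin d) ℝ)) := Ultrafilter.of Filter.atTop
    let ψ : MvPolynomial (Fin d) ℝ →+*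
        Filter.Germ (𝒰 : Filter (Finset (MvPolynomial (Fin d) ℝ))) ℝ :=
      (germHom 𝒰).comp (RingHom.pi fun T => eval (a T))
    have hs : ∀ f, 0 < eval₂Hom ι (Fin.tail ξ) f ↔ 0 < ψ f := by
      intro f
      have hmem : ∀ᶠ T in (𝒰 : Filter (Finset (MvPolynomial (Fin d) ℝ))), f ∈ T := by
        refine Ultrafilter.of_le _ ?_
        filter_upwards [Filter.eventually_ge_atTop {f}] with T hT using hT (by simp)
      have hψ : 0 < ψ f ↔ ∀ᶠ T in (𝒰 : Filter (Finset (MvPolynomial (Fin d) ℝ))),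
          0 < eval (a T) f := germHom_pos 𝒰
      rw [hψ]
      constructor
      · intro h
        filter_upwards [hmem] with T hT using (ha T f hT).1 h
      · intro h
        obtain ⟨T, h1, h2⟩ := (hmem.and h).exists
        exact (ha T f h1).2 h2
    obtain ⟨w, hw⟩ := exists_same_sign_transfer hΩ (polyIVT_germ 𝒰) hs
      (S.image (finSuccEquiv ℝ d)) (ξ 0)
    obtain ⟨u, rfl⟩ : ∃ u, germHom 𝒰 u = w := Quotient.mk''_surjective w
    have hall : ∀ᶠ T in (𝒰 : Filter (Finset (MvPolynomial (Fin d) ℝ))), ∀ f ∈ S,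
        (0 < eval₂ ι ξ f ↔ 0 < eval (Fin.cons (u T) (a T) : Fin (d + 1) → ℝ) f) := by
      rw [Filter.eventually_all_finset]
      intro f hf
      have h := hw _ (Finset.mem_image_of_mem _ hf)
      have e1 : (finSuccEquiv ℝ d f).eval₂ (eval₂Hom ι (Fin.tail ξ)) (ξ 0) = eval₂ ι ξ f := by
        rw [eval₂_finSuccEquiv]
        congr 1
        · ext; simp
        · ext j
          refine Fin.cases ?_ (fun j => ?_) j <;> simp [Fin.tail]
      have e2 : (finSuccEquiv ℝ d f).eval₂ ψ (germHom 𝒰 u) =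
          germHom 𝒰 fun T => eval (Fin.cons (u T) (a T) : Fin (d + 1) → ℝ) f := by
        rw [eval₂_finSuccEquiv]
        have : eval₂Hom (ψ.comp C) (Fin.cons (germHom 𝒰 u) fun j => ψ (X j)) =
            (germHom 𝒰).comp (RingHom.pi fun T =>
              eval (Fin.cons (u T) (a T) : Fin (d + 1) → ℝ)) := by
          refine MvPolynomial.ringHom_ext (fun r => ?_) (fun i => ?_)
          · simp only [coe_eval₂Hom, eval₂_C, ψ, RingHom.comp_apply]
            congr 1
            ext T
            simp
          · refine Fin.cases ?_ (fun j => ?_) i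
            · simp only [coe_eval₂Hom, eval₂_X, RingHom.comp_apply, Fin.cons_zero]
              congr 1
              ext T
              simp
            · simp only [coe_eval₂Hom, eval₂_X, RingHom.comp_apply, Fin.cons_succ, ψ]
              congr 1
              ext T
              simp
        exact congrArg (fun g => g f) this
      rw [e1, e2, germHom_pos] at h
      by_cases hpos : 0 < eval₂ ι ξ f
      · filter_upwards [h.1 hpos] with T hT using iff_of_true hpos hT
      · filter_upwards [Ultrafilter.eventually_not.2 (mt h.2 hpos)] with T hT
          using iff_of_false hpos hT
    obtain ⟨T, hT⟩ := hall.exists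
    exact ⟨_, hT⟩

end ArtinLang

section SignChangingDivisor

variable {E : Type*} [Field E] [LinearOrder E] [IsStrictOrderedRing E]

lemma exists_irreducible_sign_change {f : Polynomial E} {a b : E}
    (hf : f.eval a * f.eval b < 0) :
    ∃ p, Irreducible p ∧ p ∣ f ∧ p.eval a * p.eval b < 0 := by
  induction f using WfDvdMonoid.induction_on_irreducible with
  | zero => simp at hf
  | unit u hu =>
    obtain ⟨c, -, rfl⟩ := Polynomial.isUnit_iff.1 hu
    simp only [Polynomial.eval_C] at hf
    exact absurd hf (not_lt.2 (mul_self_nonneg c))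
  | mul g p hg hp ih =>
    by_cases hpn : p.eval a * p.eval b < 0
    · exact ⟨p, hp, dvd_mul_right _ _, hpn⟩
    · have hgn : g.eval a * g.eval b < 0 := by
        by_contra hgn
        rw [Polynomial.eval_mul, Polynomial.eval_mul] at hf
        nlinarith [mul_nonneg (not_lt.1 hpn) (not_lt.1 hgn)]
      obtain ⟨q, hq, hqg, hqn⟩ := ih hgn
      exact ⟨q, hq, hqg.mul_left p, hqn⟩

variable {ι : Type*} [Fintype ι] {c : ι → E}

lemma eval_sum_C_mul_sq (r : ι → Polynomial E) (x : E) :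
    (∑ i, Polynomial.C (c i) * r i ^ 2).eval x = ∑ i, c i * (r i).eval x ^ 2 := by
  simp [Polynomial.eval_finsetSum]

lemma eval_eq_zero_of_sum_C_mul_sq (hc : ∀ i, 0 < c i) {r : ι → Polynomial E} {x : E}
    (h : (∑ i, Polynomial.C (c i) * r i ^ 2).eval x = 0) (i : ι) : (r i).eval x = 0 := by
  rw [eval_sum_C_mul_sq, Finset.sum_eq_zero_iff_of_nonneg
    fun i _ => mul_nonneg (hc i).le (sq_nonneg _)] at h
  simpa [(hc i).ne'] using h i (Finset.mem_univ i)

lemma eq_zero_of_sum_C_mul_sq (hc : ∀ i, 0 < c i) {r : ι → Polynomial E}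
    (h : ∑ i, Polynomial.C (c i) * r i ^ 2 = 0) (i : ι) : r i = 0 :=
  Polynomial.funext fun x => by
    simpa using eval_eq_zero_of_sum_C_mul_sq hc (x := x) (by rw [h, Polynomial.eval_zero]) i

/-- An irreducible polynomial that changes sign divides each term of a positively weighted sum
of squares that it divides. -/
theorem dvd_of_dvd_sum_C_mul_sq {a b : E} {p : Polynomial E} (hp : Irreducible p)
    (hab : p.eval a * p.eval b < 0) (hc : ∀ i, 0 < c i) {g : ι → Polynomial E}
    (hdvd : p ∣ ∑ i, Polynomial.C (c i) * g i ^ 2) (i : ι) : p ∣ g i := by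
  induction hn : p.natDegree using Nat.strong_induction_on generalizing p g i with
  | _ n ih =>
  subst hn
  have hpa : p.eval a ≠ 0 := fun h => by simp [h] at hab
  have hpb : p.eval b ≠ 0 := fun h => by simp [h] at hab
  have hpos := hp.natDegree_pos
  suffices key : ∀ N : ℕ, ∀ (h : Polynomial E) (r : ι → Polynomial E), h.natDegree = N →
      (∀ i, (r i).natDegree < p.natDegree) → ∑ i, Polynomial.C (c i) * r i ^ 2 = p * h →
      ∀ i, r i = 0 by
    have hd : p ∣ ∑ i, Polynomial.C (c i) * (g i % p) ^ 2 := by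
      have : p ∣ ∑ i, Polynomial.C (c i) * g i ^ 2 -
          ∑ i, Polynomial.C (c i) * (g i % p) ^ 2 := by
        rw [← Finset.sum_sub_distrib]
        refine Finset.dvd_sum fun i _ => ?_
        rw [← mul_sub, sq_sub_sq]
        exact (Dvd.intro (g i / p) (by linear_combination EuclideanDomain.div_add_mod (g i) p)
          |>.mul_left _).mul_left _
      exact (dvd_sub_right hdvd).1 this
    obtain ⟨h, hh⟩ := hd
    exact EuclideanDomain.mod_eq_zero.1 (key _ h _ rfl
      (fun i => Polynomial.natDegree_mod_lt _ hpos.ne') hh i)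
  intro N
  induction N using Nat.strong_induction_on with
  | _ N ihN =>
  rintro h r rfl hr hsum
  rcases eq_or_ne h 0 with rfl | h0
  · exact eq_zero_of_sum_C_mul_sq hc (by rw [hsum, mul_zero])
  obtain ⟨q, hq, hqp, hqh, hqr⟩ : ∃ q : Polynomial E, Irreducible q ∧ ¬ q ∣ p ∧ q ∣ h ∧
      ∀ i, q ∣ r i := by
    have root : ∀ x, p.eval x ≠ 0 → h.eval x = 0 → ∃ q : Polynomial E, Irreducible q ∧
        ¬ q ∣ p ∧ q ∣ h ∧ ∀ i, q ∣ r i := fun x hpx hx =>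
      ⟨Polynomial.X - Polynomial.C x, Polynomial.irreducible_X_sub_C x,
        fun hd => hpx (Polynomial.dvd_iff_isRoot.1 hd), Polynomial.dvd_iff_isRoot.2 hx,
        fun i => Polynomial.dvd_iff_isRoot.2 (eval_eq_zero_of_sum_C_mul_sq hc
          (by rw [hsum, Polynomial.eval_mul, hx, mul_zero]) i)⟩
    by_cases ha : h.eval a = 0
    · exact root a hpa ha
    by_cases hb : h.eval b = 0
    · exact root b hpb hb
    have hnonneg : ∀ x, 0 ≤ p.eval x * h.eval x := fun x => by
      rw [← Polynomial.eval_mul, ← hsum, eval_sum_C_mul_sq]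
      exact Finset.sum_nonneg fun i _ => mul_nonneg (hc i).le (sq_nonneg _)
    have hhab : h.eval a * h.eval b < 0 := by
      have h1 := mul_pos ((hnonneg a).lt_of_ne' (mul_ne_zero hpa ha))
        ((hnonneg b).lt_of_ne' (mul_ne_zero hpb hb))
      rw [mul_mul_mul_comm] at h1
      exact (neg_iff_neg_of_mul_pos h1).1 hab
    obtain ⟨q, hq, hqh, hqab⟩ := exists_irreducible_sign_change hhab
    have hlt : q.natDegree < p.natDegree := by
      refine (Polynomial.natDegree_le_of_dvd hqh h0).trans_lt ?_
      have h1 : (p * h).natDegree ≤ 2 * (p.natDegree - 1) := by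
        rw [← hsum]
        refine Polynomial.natDegree_sum_le_of_forall_le _ _ fun i _ => ?_
        refine (Polynomial.natDegree_C_mul_le _ _).trans
          (Polynomial.natDegree_pow_le.trans ?_)
        have := hr i
        omega
      rw [Polynomial.natDegree_mul hp.ne_zero h0] at h1
      omega
    refine ⟨q, hq, fun hd => hlt.ne ?_, hqh, fun i => ih _ hlt hq hqab ?_ i rfl⟩
    · exact Polynomial.natDegree_eq_of_degree_eq
        (Polynomial.degree_eq_degree_of_associated (hq.associated_of_dvd hp hd))
    · exact hsum ▸ hqh.mul_left p
  choose r' hr' using hqr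
  have hcop : IsCoprime (q ^ 2) p := ((hq.coprime_iff_not_dvd).2 hqp).pow_left
  obtain ⟨h', rfl⟩ : q ^ 2 ∣ h := by
    refine hcop.dvd_of_dvd_mul_left (hsum ▸ Finset.dvd_sum fun i _ => ?_)
    rw [hr' i, mul_pow]
    exact (dvd_mul_right _ _).mul_left _
  have hq0 := hq.ne_zero
  have hh'0 : h' ≠ 0 := right_ne_zero_of_mul h0
  have hz : ∀ i, r' i = 0 := by
    refine ihN h'.natDegree ?_ h' r' rfl (fun i => ?_) ?_
    · rw [Polynomial.natDegree_mul (pow_ne_zero 2 hq0) hh'0, Polynomial.natDegree_pow]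
      have := hq.natDegree_pos
      omega
    · rcases eq_or_ne (r' i) 0 with h | h
      · simpa [h] using hpos
      · have := hr i
        rw [hr' i, Polynomial.natDegree_mul hq0 h] at this
        omega
    · refine mul_left_cancel₀ (pow_ne_zero 2 hq0) ?_
      rw [Finset.mul_sum, mul_left_comm, ← hsum]
      refine Finset.sum_congr rfl fun i _ => ?_
      rw [hr' i]
      ring
  intro i
  rw [hr' i, hz i, mul_zero]

end SignChangingDivisor

section Precone

universe u

variable {L : Type u} [Field L]

/-- A subsemiring is a precone if it contains no nonzero element together with its negative and
contains the squares of all differences of its elements. -/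
structure IsPrecone (T : Subsemiring L) : Prop where
  eq_zero : ∀ x ∈ T, -x ∈ T → x = 0
  sub_sq_mem : ∀ a ∈ T, ∀ b ∈ T, (a - b) ^ 2 ∈ T

lemma exists_maximal_isPrecone {T₀ : Subsemiring L} (h₀ : IsPrecone T₀) :
    ∃ T, T₀ ≤ T ∧ Maximal IsPrecone T := by
  refine zorn_le_nonempty₀ {T | IsPrecone T} (fun c hc hchain y hy => ?_) T₀ h₀
  have hdir := hchain.directedOn
  refine ⟨sSup c, ⟨fun x hx hx' => ?_, fun a ha b hb => ?_⟩, fun z hz => le_sSup hz⟩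
  · obtain ⟨G, hG, hxG⟩ := (Subsemiring.mem_sSup_of_directedOn ⟨y, hy⟩ hdir).1 hx
    obtain ⟨G', hG', hxG'⟩ := (Subsemiring.mem_sSup_of_directedOn ⟨y, hy⟩ hdir).1 hx'
    obtain ⟨M, hM, h1, h2⟩ := hdir G hG G' hG'
    exact (hc hM).eq_zero x (h1 hxG) (h2 hxG')
  · obtain ⟨G, hG, hxG⟩ := (Subsemiring.mem_sSup_of_directedOn ⟨y, hy⟩ hdir).1 ha
    obtain ⟨G', hG', hxG'⟩ := (Subsemiring.mem_sSup_of_directedOn ⟨y, hy⟩ hdir).1 hb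
    obtain ⟨M, hM, h1, h2⟩ := hdir G hG G' hG'
    exact le_sSup hM ((hc hM).sub_sq_mem a (h1 hxG) b (h2 hxG'))

lemma Subsemiring.inv_mem_of_maximal_isPrecone {T : Subsemiring L} (hT : Maximal IsPrecone T)
    {x : L} (hx : x ∈ T) : x⁻¹ ∈ T := by
  let T' : Subsemiring L :=
    { carrier := {p | ∃ a ∈ T, ∃ b ∈ T, b ≠ 0 ∧ p * b = a}
      mul_mem' := by
        rintro p q ⟨a, ha, b, hb, hb0, rfl⟩ ⟨a', ha', b', hb', hb0', rfl⟩
        exact ⟨_, mul_mem ha ha', _, mul_mem hb hb', mul_ne_zero hb0 hb0', by ring⟩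
      one_mem' := ⟨1, one_mem T, 1, one_mem T, by simp, by simp⟩
      add_mem' := by
        rintro p q ⟨a, ha, b, hb, hb0, rfl⟩ ⟨a', ha', b', hb', hb0', rfl⟩
        exact ⟨_, add_mem (mul_mem ha hb') (mul_mem ha' hb), _, mul_mem hb hb',
          mul_ne_zero hb0 hb0', by ring⟩
      zero_mem' := ⟨0, zero_mem T, 1, one_mem T, by simp, by simp⟩ }
  have hT' : IsPrecone T' := by
    refine ⟨?_, ?_⟩
    · rintro p ⟨a, ha, b, hb, hb0, hab⟩ ⟨a', ha', b', hb', hb0', hab'⟩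
      have h := hT.prop.eq_zero (p * (b * b')) (by
        have := mul_mem ha hb'
        rwa [← hab, mul_assoc] at this) (by
        have := mul_mem ha' hb
        rwa [← hab', show -p * b' * b = -(p * (b * b')) by ring] at this)
      simpa [hb0, hb0'] using h
    · rintro p ⟨a, ha, b, hb, hb0, hab⟩ q ⟨a', ha', b', hb', hb0', hab'⟩
      refine ⟨_, hT.prop.sub_sq_mem _ (mul_mem ha hb') _ (mul_mem ha' hb), (b * b') ^ 2,
        pow_mem (mul_mem hb hb') 2, by simp [hb0, hb0'], ?_⟩
      rw [← hab, ← hab']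
      ring
  rcases eq_or_ne x 0 with rfl | hx0
  · simp
  · exact hT.le_of_ge hT' (fun y hy => ⟨y, hy, 1, one_mem T, by simp, by simp⟩)
      ⟨1, one_mem T, x, hx, hx0, inv_mul_cancel₀ hx0⟩

lemma Subsemiring.mem_or_neg_mem_of_maximal_isPrecone {T : Subsemiring L}
    (hT : Maximal IsPrecone T) {s t : L} (hs : s ∈ T) (ht : t ∈ T) :
    s - t ∈ T ∨ -(s - t) ∈ T := by
  by_contra! hcon
  obtain ⟨hx, hx'⟩ := hcon
  have hxx := hT.prop.sub_sq_mem s hs t ht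
  set x := s - t with hxdef
  let T' : Subsemiring L :=
    { carrier := {p | ∃ a ∈ T, ∃ b ∈ T, p = a + x * b}
      mul_mem' := by
        rintro p q ⟨a, ha, b, hb, rfl⟩ ⟨a', ha', b', hb', rfl⟩
        exact ⟨a * a' + x ^ 2 * (b * b'), add_mem (mul_mem ha ha') (mul_mem hxx (mul_mem hb hb')),
          a * b' + a' * b, add_mem (mul_mem ha hb') (mul_mem ha' hb), by ring⟩
      one_mem' := ⟨1, one_mem T, 0, zero_mem T, by simp⟩
      add_mem' := by
        rintro p q ⟨a, ha, b, hb, rfl⟩ ⟨a', ha', b', hb', rfl⟩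
        exact ⟨_, add_mem ha ha', _, add_mem hb hb', by ring⟩
      zero_mem' := ⟨0, zero_mem T, 0, zero_mem T, by simp⟩ }
  have hle : T ≤ T' := fun y hy => ⟨y, hy, 0, zero_mem T, by simp⟩
  have hT' : IsPrecone T' := by
    refine ⟨?_, ?_⟩
    · rintro y ⟨a, ha, b, hb, rfl⟩ ⟨c, hc, d, hd, hcd⟩
      have hbd : b + d = 0 := by
        by_contra hne
        refine hx' ?_
        have := mul_mem (add_mem ha hc)
          (Subsemiring.inv_mem_of_maximal_isPrecone hT (add_mem hb hd))
        rwa [show a + c = -x * (b + d) by linear_combination -hcd,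
          mul_inv_cancel_right₀ hne] at this
      have hb0 := hT.prop.eq_zero b hb (by rwa [← eq_neg_of_add_eq_zero_right hbd])
      have hd0 : d = 0 := by simpa [hb0] using hbd
      subst hb0 hd0
      simp only [mul_zero, add_zero] at hcd ⊢
      exact hT.prop.eq_zero a ha (by rwa [hcd])
    · rintro p ⟨a, ha, b, hb, rfl⟩ q ⟨a', ha', b', hb', rfl⟩
      refine hle ?_
      convert hT.prop.sub_sq_mem (a + s * b + t * b') (add_mem (add_mem ha (mul_mem hs hb))
        (mul_mem ht hb')) (a' + t * b + s * b') (add_mem (add_mem ha' (mul_mem ht hb))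
        (mul_mem hs hb')) using 1
      rw [hxdef]
      ring
  exact hx (hT.le_of_ge hT' hle ⟨0, zero_mem T, 1, one_mem T, by simp⟩)

/-- The differences of elements of a maximal precone form an ordered field whose nonnegative
elements are the elements of the precone. -/
lemma exists_orderedField_of_maximal_isPrecone {T : Subsemiring L} (hT : Maximal IsPrecone T) :
    ∃ (E : Type u) (_ : Field E) (_ : LinearOrder E) (_ : IsStrictOrderedRing E) (i : E →+* L),
      (∀ x, 0 ≤ x ↔ i x ∈ T) ∧ ∀ a ∈ T, ∀ b ∈ T, a - b ∈ Set.range i := by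
  classical
  let E : Subfield L :=
    { carrier := {x | ∃ a ∈ T, ∃ b ∈ T, x = a - b}
      mul_mem' := by
        rintro p q ⟨a, ha, b, hb, rfl⟩ ⟨a', ha', b', hb', rfl⟩
        exact ⟨_, add_mem (mul_mem ha ha') (mul_mem hb hb'), _,
          add_mem (mul_mem ha hb') (mul_mem hb ha'), by ring⟩
      one_mem' := ⟨1, one_mem T, 0, zero_mem T, by simp⟩
      add_mem' := by
        rintro p q ⟨a, ha, b, hb, rfl⟩ ⟨a', ha', b', hb', rfl⟩
        exact ⟨_, add_mem ha ha', _, add_mem hb hb', by ring⟩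
      zero_mem' := ⟨0, zero_mem T, 0, zero_mem T, by simp⟩
      neg_mem' := by
        rintro p ⟨a, ha, b, hb, rfl⟩
        exact ⟨b, hb, a, ha, by ring⟩
      inv_mem' := by
        rintro p ⟨a, ha, b, hb, rfl⟩
        have h := Subsemiring.inv_mem_of_maximal_isPrecone hT (hT.prop.sub_sq_mem a ha b hb)
        refine ⟨_, mul_mem ha h, _, mul_mem hb h, ?_⟩
        rcases eq_or_ne (a - b) 0 with h0 | h0
        · simp [h0]
        · field_simp }
  let cone : RingCone E :=
    { T.comap E.subtype with
      eq_zero_of_mem_of_neg_mem' := fun {x} hx hx' =>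
        Subtype.ext (hT.prop.eq_zero x.1 hx hx') }
  have : HasMemOrNegMem cone := ⟨fun ⟨x, a, ha, b, hb, h⟩ => by
    subst h
    exact Subsemiring.mem_or_neg_mem_of_maximal_isPrecone hT ha hb⟩
  let _ : LinearOrder E := .mkOfAddGroupCone cone
  have h1 : IsOrderedRing E := .mkOfCone cone
  have h2 : IsStrictOrderedRing E := IsOrderedRing.toIsStrictOrderedRing E
  refine ⟨E, inferInstance, inferInstance, h2, E.subtype, fun x => ?_, fun a ha b hb =>
    ⟨⟨_, a, ha, b, hb, rfl⟩, rfl⟩⟩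
  change x - 0 ∈ cone ↔ _
  rw [sub_zero]
  rfl

end Precone

section OrderedExtension

universe u

lemma Polynomial.dvd_of_eval₂_eq_zero {E L : Type*} [Field E] [Field L] {i : E →+* L}
    {p g : Polynomial E} (hp : Irreducible p) {α : L} (hα : p.eval₂ i α = 0)
    (hg : g.eval₂ i α = 0) : p ∣ g := by
  by_contra h
  obtain ⟨u, v, huv⟩ := hp.coprime_iff_not_dvd.2 h
  simpa [Polynomial.eval₂_add, Polynomial.eval₂_mul, hα, hg] using
    congrArg (Polynomial.eval₂ i α) huv

section

variable (E : Type*) [Field E] [LinearOrder E] [IsStrictOrderedRing E]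

/-- The positively weighted squares of polynomials. -/
def weightedSquares : Submonoid (Polynomial E) where
  carrier := {x | ∃ c g, 0 < c ∧ x = Polynomial.C c * g ^ 2}
  one_mem' := ⟨1, 1, one_pos, by simp⟩
  mul_mem' := by
    rintro _ _ ⟨c, g, hc, rfl⟩ ⟨c', g', hc', rfl⟩
    exact ⟨c * c', g * g', mul_pos hc hc', by rw [Polynomial.C_mul]; ring⟩

variable {E}

lemma exists_eq_sum_of_mem_closure_weightedSquares {x : Polynomial E}
    (hx : x ∈ (weightedSquares E).subsemiringClosure) :
    ∃ (ι : Type) (_ : Fintype ι) (c : ι → E) (g : ι → Polynomial E), (∀ i, 0 < c i) ∧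
      x = ∑ i, Polynomial.C (c i) * g i ^ 2 := by
  rw [Submonoid.subsemiringClosure_mem] at hx
  induction hx using AddSubmonoid.closure_induction with
  | mem x hx =>
    obtain ⟨c, g, hc, rfl⟩ := hx
    exact ⟨Unit, inferInstance, fun _ => c, fun _ => g, fun _ => hc, by simp⟩
  | zero => exact ⟨Empty, inferInstance, Empty.elim, Empty.elim, fun i => i.elim, by simp⟩
  | add x y _ _ hx hy =>
    obtain ⟨ι, _, c, g, hc, rfl⟩ := hx
    obtain ⟨κ, _, c', g', hc', rfl⟩ := hy
    exact ⟨ι ⊕ κ, inferInstance, Sum.elim c c', Sum.elim g g', by simp [hc, hc'],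
      by simp [Fintype.sum_sum_type]⟩

lemma dvd_of_dvd_add_of_mem_closure_weightedSquares {a b : E} {p : Polynomial E}
    (hp : Irreducible p) (hab : p.eval a * p.eval b < 0) {x y : Polynomial E}
    (hx : x ∈ (weightedSquares E).subsemiringClosure)
    (hy : y ∈ (weightedSquares E).subsemiringClosure) (hxy : p ∣ x + y) : p ∣ x := by
  obtain ⟨ι, _, c, g, hc, rfl⟩ := exists_eq_sum_of_mem_closure_weightedSquares hx
  obtain ⟨κ, _, c', g', hc', rfl⟩ := exists_eq_sum_of_mem_closure_weightedSquares hy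
  have h := dvd_of_dvd_sum_C_mul_sq (c := Sum.elim c c') (g := Sum.elim g g') hp hab
    (by simp [hc, hc']) (by simpa [Fintype.sum_sum_type] using hxy)
  refine Finset.dvd_sum fun i _ => ?_
  have := h (Sum.inl i)
  rw [Sum.elim_inl] at this
  exact (dvd_pow this two_ne_zero).mul_left _

end

variable {L : Type u} [Field L]

/-- The ordered field of differences of a maximal precone in an algebraically closed field has the
intermediate value property. -/
theorem polyIVT_of_maximal_isPrecone [IsAlgClosed L] {T : Subsemiring L}
    (hT : Maximal IsPrecone T) {E : Type u} [Field E] [LinearOrder E] [IsStrictOrderedRing E]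
    {i : E →+* L} (hi : ∀ x, 0 ≤ x ↔ i x ∈ T)
    (hrange : ∀ a ∈ T, ∀ b ∈ T, a - b ∈ Set.range i) : PolyIVT E := by
  intro f a b hlt hf
  obtain ⟨p, hp, hpf, hpab⟩ := exists_irreducible_sign_change hf
  obtain ⟨α, hα⟩ := IsAlgClosed.exists_eval₂_eq_zero i p
    (Polynomial.degree_pos_of_irreducible hp).ne'
  let P := (weightedSquares E).subsemiringClosure
  have hmem : ∀ c g, 0 < c → Polynomial.C c * g ^ 2 ∈ P := fun c g hc =>
    (Submonoid.subsemiringClosure_mem _).2 (AddSubmonoid.subset_closure ⟨c, g, hc, rfl⟩)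
  let T' : Subsemiring L := P.map (Polynomial.eval₂RingHom i α)
  have hT' : IsPrecone T' := by
    refine ⟨?_, ?_⟩
    · rintro _ ⟨x, hx, rfl⟩ ⟨y, hy, hxy⟩
      have hdvd : p ∣ x + y := Polynomial.dvd_of_eval₂_eq_zero hp hα (by
        rw [Polynomial.eval₂_add]
        exact (congrArg _ hxy).trans (add_neg_cancel _))
      obtain ⟨q, rfl⟩ := dvd_of_dvd_add_of_mem_closure_weightedSquares hp hpab hx hy hdvd
      simp [Polynomial.eval₂_mul, hα]
    · rintro _ ⟨x, hx, rfl⟩ _ ⟨y, hy, rfl⟩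
      exact ⟨_, hmem 1 (x - y) one_pos, by simp [Polynomial.eval₂_pow, Polynomial.eval₂_sub]⟩
  have hle : T ≤ T' := by
    intro t ht
    obtain ⟨e, he⟩ := hrange t ht 0 (zero_mem T)
    rw [sub_zero] at he
    subst he
    rcases ((hi e).2 ht).eq_or_lt with rfl | hpos
    · rw [map_zero]
      exact zero_mem T'
    · exact ⟨_, hmem e 1 hpos, by simp⟩
  have hsq : ∀ g : Polynomial E, g.eval₂ i α ^ 2 ∈ T := fun g =>
    hT.le_of_ge hT' hle ⟨_, hmem 1 g one_pos, by simp [Polynomial.eval₂_pow]⟩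
  have h2 : i 2 = 2 := map_ofNat i 2
  have hL : (2 : L) ≠ 0 := h2 ▸ (map_ne_zero i).2 two_ne_zero
  obtain ⟨e, rfl⟩ : α ∈ Set.range i := by
    have := hrange _ (hsq (Polynomial.C 2⁻¹ * (Polynomial.X + 1))) _
      (hsq (Polynomial.C 2⁻¹ * (Polynomial.X - 1)))
    convert this
    simp [Polynomial.eval₂_mul, Polynomial.eval₂_sub, h2]
    field_simp
    ring
  have hpe : p.eval e = 0 := by
    rwa [Polynomial.eval₂_at_apply, map_eq_zero] at hα
  have hfe : f.eval e = 0 := Polynomial.eval_eq_zero_of_dvd_of_eval_eq_zero hpf hpe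
  obtain ⟨q, hq⟩ := Polynomial.dvd_iff_isRoot.2 hpe
  obtain ⟨u, -, rfl⟩ := Polynomial.isUnit_iff.1
    ((hp.isUnit_or_isUnit hq).resolve_left (Polynomial.not_isUnit_X_sub_C e))
  rw [hq] at hpab
  simp only [Polynomial.eval_mul, Polynomial.eval_sub, Polynomial.eval_X, Polynomial.eval_C]
    at hpab
  have hneg : (a - e) * (b - e) < 0 := by
    by_contra hcon
    nlinarith [mul_nonneg (not_lt.1 hcon) (mul_self_nonneg u)]
  rcases mul_neg_iff.1 hneg with ⟨h1, h2⟩ | ⟨h1, h2⟩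
  · linarith
  · exact ⟨e, by linarith, by linarith, hfe⟩

lemma isSumSq_of_isSumSq_neg_one {K : Type*} [Field K] [CharZero K] (h : IsSumSq (-1 : K)) (f : K) :
    IsSumSq f := by
  have := (IsSumSq.mul_self ((f + 1) / 2)).add (h.mul (IsSumSq.mul_self ((f - 1) / 2)))
  rwa [show (f + 1) / 2 * ((f + 1) / 2) + -1 * ((f - 1) / 2 * ((f - 1) / 2)) = f by ring] at this

/-- An element of a field that is not a sum of squares is negative for an embedding in an ordered
field with the intermediate value property. -/
theorem exists_ringHom_neg_of_not_isSumSq {K : Type u} [Field K] [CharZero K] {f : K}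
    (hf : ¬ IsSumSq f) :
    ∃ (E : Type u) (_ : Field E) (_ : LinearOrder E) (_ : IsStrictOrderedRing E)
      (φ : K →+* E), PolyIVT E ∧ φ f < 0 := by
  have hzero : ∀ x : K, IsSumSq x → IsSumSq (-x) → x = 0 := by
    intro x hx hx'
    by_contra h0
    refine hf (isSumSq_of_isSumSq_neg_one ?_ f)
    have := (hx.mul hx').mul (IsSumSq.mul_self (x⁻¹))
    convert this using 1
    field_simp
  have hsq : ∀ x : K, IsSumSq (x ^ 2) := fun x => sq x ▸ IsSumSq.mul_self x
  let T₀ : Subsemiring K :=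
    { carrier := {p | ∃ a b, IsSumSq a ∧ IsSumSq b ∧ p = a - f * b}
      mul_mem' := by
        rintro p q ⟨a, b, ha, hb, rfl⟩ ⟨a', b', ha', hb', rfl⟩
        exact ⟨a * a' + f ^ 2 * (b * b'), a * b' + a' * b,
          (ha.mul ha').add ((hsq f).mul (hb.mul hb')), (ha.mul hb').add (ha'.mul hb), by ring⟩
      one_mem' := ⟨1, 0, by simp, by simp, by simp⟩
      add_mem' := by
        rintro p q ⟨a, b, ha, hb, rfl⟩ ⟨a', b', ha', hb', rfl⟩
        exact ⟨_, _, ha.add ha', hb.add hb', by ring⟩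
      zero_mem' := ⟨0, 0, by simp, by simp, by simp⟩ }
  have hT₀ : ∀ x ∈ T₀, -x ∈ T₀ → x = 0 := by
    rintro _ ⟨a, b, ha, hb, rfl⟩ ⟨c, d, hc, hd, hcd⟩
    have hbd : b + d = 0 := by
      by_contra hne
      refine hf ?_
      have := ((ha.add hc).mul (hb.add hd)).mul (hsq (b + d)⁻¹)
      convert this using 1
      rw [show a + c = f * (b + d) by linear_combination -hcd]
      field_simp
    have hb0 := hzero b hb (by rwa [← eq_neg_of_add_eq_zero_right hbd])
    have hd0 : d = 0 := by simpa [hb0] using hbd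
    subst hb0 hd0
    simp only [mul_zero, sub_zero] at hcd ⊢
    exact hzero a ha (by rwa [hcd])
  let j := algebraMap K (AlgebraicClosure K)
  have hpre : IsPrecone (T₀.map j) := by
    refine ⟨?_, ?_⟩
    · rintro _ ⟨x, hx, rfl⟩ ⟨y, hy, hxy⟩
      rw [← map_neg] at hxy
      rw [hT₀ x hx (j.injective hxy ▸ hy), map_zero]
    · rintro _ ⟨x, hx, rfl⟩ _ ⟨y, hy, rfl⟩
      exact ⟨(x - y) ^ 2, ⟨_, 0, hsq (x - y), by simp, by simp⟩, by simp⟩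
  obtain ⟨T, hle, hT⟩ := exists_maximal_isPrecone hpre
  obtain ⟨E, _, _, _, i, hi, hrange⟩ := exists_orderedField_of_maximal_isPrecone hT
  have hjT : ∀ x : K, IsSumSq x → j x ∈ T := fun x hx =>
    hle ⟨x, ⟨x, 0, hx, by simp, by simp⟩, rfl⟩
  have hj : ∀ x, j x ∈ i.range := fun x => by
    obtain ⟨e, he⟩ := hrange _ (hjT _ (hsq ((x + 1) / 2))) _ (hjT _ (hsq ((x - 1) / 2)))
    refine ⟨e, he.trans ?_⟩
    rw [← map_sub]
    congr 1
    ring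
  let φ : K →+* E := (RingEquiv.ofBijective i.rangeRestrict
    ⟨fun x y hxy => i.injective (congrArg Subtype.val hxy), i.rangeRestrict_surjective⟩
    ).symm.toRingHom.comp
      (j.codRestrict i.range hj)
  have hφ : ∀ x, i (φ x) = j x := fun x => by
    have := RingEquiv.apply_symm_apply (RingEquiv.ofBijective i.rangeRestrict
      ⟨fun x y hxy => i.injective (congrArg Subtype.val hxy), i.rangeRestrict_surjective⟩)
      (j.codRestrict i.range hj x)
    exact congrArg Subtype.val this
  refine ⟨E, inferInstance, inferInstance, inferInstance, φ,
    polyIVT_of_maximal_isPrecone hT hi hrange, lt_of_le_of_ne ?_ ?_⟩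
  · rw [← neg_nonneg, hi, map_neg, hφ, ← map_neg]
    exact hle ⟨-f, ⟨0, 1, by simp, by simp, by simp⟩, rfl⟩
  · rw [map_ne_zero]
    rintro rfl
    exact hf IsSumSq.zero

end OrderedExtension

section ScalarArtin

lemma exists_sq_mul_isSumSq_of_fractionRing {A K : Type*} [CommRing A] [IsDomain A] [Field K]
    [Algebra A K] [IsFractionRing A K] {y : K} (hy : IsSumSq y) :
    ∃ q : A, q ≠ 0 ∧ ∃ s, IsSumSq s ∧ algebraMap A K (q ^ 2) * y = algebraMap A K s := by
  induction hy with
  | zero => exact ⟨1, one_ne_zero, 0, .zero, by simp⟩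
  | sq_add a hs ih =>
    obtain ⟨q, hq, s, hs, h⟩ := ih
    obtain ⟨n, e, he, rfl⟩ := IsFractionRing.div_surjective (A := A) a
    have he0 := nonZeroDivisors.ne_zero he
    have he1 : algebraMap A K e ≠ 0 := by simpa using he0
    refine ⟨q * e, mul_ne_zero hq he0, (q * n) * (q * n) + (e * e) * s,
      (IsSumSq.mul_self _).add ((IsSumSq.mul_self _).mul hs), ?_⟩
    simp only [map_add, map_mul, map_pow] at h ⊢
    rw [← h]
    field_simp

/-- Artin's theorem: a nonnegative real polynomial becomes a sum of squares of polynomials after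
multiplication by a nonzero square. -/
theorem exists_sq_mul_isSumSq_of_nonneg {d : ℕ} {f : MvPolynomial (Fin d) ℝ}
    (hf : ∀ x, 0 ≤ eval x f) : ∃ q, q ≠ 0 ∧ IsSumSq (q ^ 2 * f) := by
  let K := FractionRing (MvPolynomial (Fin d) ℝ)
  by_cases h : IsSumSq (algebraMap (MvPolynomial (Fin d) ℝ) K f)
  · obtain ⟨q, hq, s, hs, h⟩ :=
      exists_sq_mul_isSumSq_of_fractionRing (A := MvPolynomial (Fin d) ℝ) h
    rw [← map_mul] at h
    exact ⟨q, hq, by rwa [IsFractionRing.injective (MvPolynomial (Fin d) ℝ) K h]⟩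
  · have : CharZero K := algebraRat.charZero K
    obtain ⟨Ω, _, _, _, φ, hΩ, hneg⟩ := exists_ringHom_neg_of_not_isSumSq h
    let ψ := φ.comp (algebraMap (MvPolynomial (Fin d) ℝ) K)
    obtain ⟨a, ha⟩ := exists_real_point_same_sign hΩ (ψ.comp C) (fun i => ψ (X i)) {-f}
    have hψ : eval₂Hom (ψ.comp C) (fun i => ψ (X i)) = ψ :=
      MvPolynomial.ringHom_ext (by simp) (by simp)
    have h1 := ha (-f) (by simp)
    have h2 : eval₂ (ψ.comp C) (fun i => ψ (X i)) (-f) = ψ (-f) := congrArg (fun g => g (-f)) hψ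
    rw [h2, map_neg, map_neg, neg_pos, neg_pos] at h1
    exact absurd (h1.1 hneg) (not_lt.2 (hf a))

end ScalarArtin

section SignChange

variable {A : Type*} [CommRing A] [IsDomain A]

lemma exists_linear_combination_eq_C_of_not_dvd [IsGCDMonoid A] {T a : Polynomial A}
    (hT : Irreducible T) (hdeg : T.natDegree ≠ 0) (ha : ¬ T ∣ a) :
    ∃ (U V : Polynomial A) (r : A), r ≠ 0 ∧ U * T + V * a = Polynomial.C r := by
  let K := FractionRing A
  have hprim := hT.isPrimitive hdeg
  have hirr := (hprim.irreducible_iff_irreducible_map_fraction_map (K := K)).1 hT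
  obtain ⟨u, v, huv⟩ := hirr.coprime_iff_not_dvd.2
    fun h => ha (hprim.dvd_of_fraction_map_dvd_fraction_map (K := K) h)
  obtain ⟨b, hb, hU⟩ := IsLocalization.integerNormalization_spec (nonZeroDivisors A) u
  obtain ⟨c, hc, hV⟩ := IsLocalization.integerNormalization_spec (nonZeroDivisors A) v
  refine ⟨Polynomial.C c * IsLocalization.integerNormalization (nonZeroDivisors A) u,
    Polynomial.C b * IsLocalization.integerNormalization (nonZeroDivisors A) v, b * c,
    nonZeroDivisors.ne_zero (mul_mem hb hc),
    Polynomial.map_injective _ (IsFractionRing.injective A K) ?_⟩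
  simp only [Polynomial.map_add, Polynomial.map_mul, hU, hV, Polynomial.map_C, map_mul,
    Algebra.smul_def, Polynomial.algebraMap_apply]
  rw [← mul_one (_ * Polynomial.C (algebraMap A K c)), ← huv]
  ring

variable {d : ℕ}

/-- Translation of the coefficients by `v` times the variable, as an endomorphism of a polynomial
ring over a multivariate polynomial ring. -/
def shiftHom (v : Fin d → ℝ) :
    Polynomial (MvPolynomial (Fin d) ℝ) →+* Polynomial (MvPolynomial (Fin d) ℝ) :=
  Polynomial.eval₂RingHom (eval₂Hom (Polynomial.C.comp C)
    fun i => Polynomial.C (X i) + Polynomial.C (C (v i)) * Polynomial.X) Polynomial.X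

lemma shiftHom_comp_neg (v : Fin d → ℝ) :
    (shiftHom v).comp (shiftHom (-v)) = RingHom.id _ := by
  refine Polynomial.ringHom_ext' (MvPolynomial.ringHom_ext (fun r => ?_) fun i => ?_) ?_
  · simp [shiftHom]
  · simp [shiftHom]
    ring
  · simp [shiftHom]

/-- The automorphism underlying `shiftHom`. -/
def shiftEquiv (v : Fin d → ℝ) :
    Polynomial (MvPolynomial (Fin d) ℝ) ≃+* Polynomial (MvPolynomial (Fin d) ℝ) :=
  RingEquiv.ofRingHom (shiftHom v) (shiftHom (-v)) (shiftHom_comp_neg v)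
    (by simpa using shiftHom_comp_neg (-v))

lemma eval_shiftEquiv_C (v w : Fin d → ℝ) (s : ℝ) (f : MvPolynomial (Fin d) ℝ) :
    (shiftEquiv v (Polynomial.C f)).eval₂ (eval w) s = eval (w + s • v) f := by
  have : ((Polynomial.eval₂RingHom (eval w) s).comp (shiftHom v)).comp Polynomial.C =
      eval (w + s • v) := by
    refine MvPolynomial.ringHom_ext (fun r => ?_) fun i => ?_
    · simp [shiftHom]
    · simp [shiftHom]
      ring
  exact congrArg (fun g => g f) this

lemma eq_zero_of_eventually_eval_eq_zero {r : MvPolynomial (Fin d) ℝ} {x : Fin d → ℝ}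
    (h : ∀ᶠ w in nhds x, eval w r = 0) : r = 0 := by
  obtain ⟨ε, hε, hball⟩ := Metric.eventually_nhds_iff_ball.1 h
  refine MvPolynomial.funext_set (fun i => Metric.ball (x i) ε) (fun i => ?_) fun w hw => ?_
  · rw [Real.ball_eq_Ioo]
    exact Set.Ioo_infinite (by linarith)
  · rw [map_zero]
    exact hball w (by rwa [ball_pi x hε])

/-- A real irreducible polynomial that changes sign divides every polynomial that vanishes on its
real zero set. -/
theorem dvd_of_sign_change {t : MvPolynomial (Fin d) ℝ} (ht : Irreducible t) {x y : Fin d → ℝ}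
    (hx : 0 < eval x t) (hy : eval y t < 0) {a : MvPolynomial (Fin d) ℝ}
    (ha : ∀ w, eval w t = 0 → eval w a = 0) : t ∣ a := by
  by_contra hta
  set v := y - x with hv
  set T := shiftEquiv v (Polynomial.C t) with hTdef
  have hT : Irreducible T := (MulEquiv.irreducible_iff (shiftEquiv v)).2
    ((Polynomial.prime_C_iff.2 ht.prime).irreducible)
  have hev := fun w s => eval_shiftEquiv_C v w s t
  have hdeg : T.natDegree ≠ 0 := by
    intro h
    have h0 := hev x 0
    have h1 := hev x 1
    rw [← hTdef, Polynomial.eq_C_of_natDegree_eq_zero h, Polynomial.eval₂_C] at h0 h1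
    have h2 := h0.symm.trans h1
    rw [zero_smul, one_smul, add_zero, hv, add_sub_cancel] at h2
    linarith
  have hTa : ¬ T ∣ shiftEquiv v (Polynomial.C a) := fun h => hta <| by
    simpa using (Polynomial.C_dvd_iff_dvd_coeff _ _).1 ((map_dvd_iff (shiftEquiv v)).1 h) 0
  obtain ⟨U, V, r, hr, hUV⟩ := exists_linear_combination_eq_C_of_not_dvd hT hdeg hTa
  refine hr (eq_zero_of_eventually_eval_eq_zero (x := x) ?_)
  have hcont := (MvPolynomial.continuous_eval t)
  have h1 : ∀ᶠ w in nhds x, 0 < eval w t :=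
    hcont.continuousAt.eventually (lt_mem_nhds hx)
  have h2 : ∀ᶠ w in nhds x, eval (w + (1 : ℝ) • v) t < 0 := by
    have hc : Continuous fun w => eval (w + (1 : ℝ) • v) t := hcont.comp (by fun_prop)
    exact hc.continuousAt.eventually (gt_mem_nhds (by simpa [hv] using hy))
  filter_upwards [h1, h2] with w hw1 hw2
  have hc : Continuous fun s : ℝ => eval (w + s • v) t := hcont.comp (by fun_prop)
  obtain ⟨s, -, hs⟩ := intermediate_value_Icc' (zero_le_one (α := ℝ)) hc.continuousOn
    ⟨hw2.le, by simpa using hw1.le⟩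
  have := congrArg (Polynomial.eval₂ (eval w) s) hUV
  rw [Polynomial.eval₂_add, Polynomial.eval₂_mul, Polynomial.eval₂_mul, hTdef,
    eval_shiftEquiv_C, eval_shiftEquiv_C, Polynomial.eval₂_C, ha _ hs] at this
  rw [← this]
  simp [show eval (w + s • v) t = 0 from hs]

end SignChange

section ComplexPolynomials

variable {d : ℕ}

lemma conjPoly_add (p q : MvPolynomial (Fin d) ℂ) :
    conjPoly (p + q) = conjPoly p + conjPoly q := map_add _ _ _

lemma conjPoly_mul (p q : MvPolynomial (Fin d) ℂ) :
    conjPoly (p * q) = conjPoly p * conjPoly q := map_mul _ _ _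

lemma conjPoly_toℂ (s : MvPolynomial (Fin d) ℝ) : conjPoly (toℂ s) = toℂ s := by
  induction s using MvPolynomial.induction_on <;> simp_all [conjPoly, toℂ]

lemma conjPoly_C (c : ℂ) : conjPoly (C c : MvPolynomial (Fin d) ℂ) = C (starRingEnd ℂ c) :=
  map_C _ _

lemma toℂ_add (s t : MvPolynomial (Fin d) ℝ) : toℂ (s + t) = toℂ s + toℂ t := map_add _ _ _

lemma toℂ_mul (s t : MvPolynomial (Fin d) ℝ) : toℂ (s * t) = toℂ s * toℂ t := map_mul _ _ _

lemma toℂ_pow (s : MvPolynomial (Fin d) ℝ) (n : ℕ) : toℂ (s ^ n) = toℂ s ^ n := map_pow _ _ _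

lemma toℂ_injective : Function.Injective (toℂ : MvPolynomial (Fin d) ℝ → _) :=
  map_injective _ (algebraMap ℝ ℂ).injective

lemma eval_conjPoly_real (x : Fin d → ℝ) (p : MvPolynomial (Fin d) ℂ) :
    eval (fun t => (x t : ℂ)) (conjPoly p) = starRingEnd ℂ (eval (fun t => (x t : ℂ)) p) := by
  induction p using MvPolynomial.induction_on <;> simp_all [conjPoly]

lemma eval_toℂ_real (x : Fin d → ℝ) (s : MvPolynomial (Fin d) ℝ) :
    eval (fun t => (x t : ℂ)) (toℂ s) = (eval x s : ℂ) := by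
  rw [toℂ, eval_map]
  exact (eval₂_comp (algebraMap ℝ ℂ) x s).symm

lemma MvPolynomial.eq_of_eval_real_eq {p q : MvPolynomial (Fin d) ℂ}
    (h : ∀ x : Fin d → ℝ, eval (fun t => (x t : ℂ)) p = eval (fun t => (x t : ℂ)) q) : p = q := by
  refine MvPolynomial.funext_set (fun _ => Set.range ((↑) : ℝ → ℂ))
    (fun _ => Set.infinite_range_of_injective Complex.ofReal_injective) fun z hz => ?_
  choose x hx using fun i => hz i (Set.mem_univ i)
  obtain rfl : (fun t => (x t : ℂ)) = z := _root_.funext hx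
  exact h x

lemma exists_eq_toℂ_add (p : MvPolynomial (Fin d) ℂ) :
    ∃ u v, p = toℂ u + C Complex.I * toℂ v := by
  induction p using MvPolynomial.induction_on with
  | C c =>
    refine ⟨C c.re, C c.im, ?_⟩
    rw [toℂ, toℂ, map_C, map_C, ← C_mul, ← C_add, mul_comm]
    congr 1
    exact (Complex.re_add_im c).symm
  | add p q hp hq =>
    obtain ⟨u, v, rfl⟩ := hp
    obtain ⟨u', v', rfl⟩ := hq
    exact ⟨u + u', v + v', by rw [toℂ_add, toℂ_add]; ring⟩
  | mul_X p i hp =>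
    obtain ⟨u, v, rfl⟩ := hp
    refine ⟨u * X i, v * X i, ?_⟩
    rw [toℂ_mul, toℂ_mul, show toℂ (X i : MvPolynomial (Fin d) ℝ) = X i from map_X _ _]
    ring

lemma C_I_mul_C_I : (C Complex.I * C Complex.I : MvPolynomial (Fin d) ℂ) = -1 := by
  rw [← C_mul, Complex.I_mul_I, C_neg, C_1]

lemma mul_conjPoly_toℂ_add (u v : MvPolynomial (Fin d) ℝ) :
    (toℂ u + C Complex.I * toℂ v) * conjPoly (toℂ u + C Complex.I * toℂ v) =
      toℂ (u ^ 2 + v ^ 2) := by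
  rw [conjPoly_add, conjPoly_mul, conjPoly_toℂ, conjPoly_toℂ, conjPoly_C, Complex.conj_I, C_neg,
    toℂ_add, toℂ_pow, toℂ_pow]
  linear_combination -(toℂ v) ^ 2 * C_I_mul_C_I (d := d)

lemma exists_eq_toℂ_of_eval_real {p : MvPolynomial (Fin d) ℂ}
    (h : ∀ x : Fin d → ℝ, (eval (fun t => (x t : ℂ)) p).im = 0) : ∃ u, p = toℂ u := by
  obtain ⟨u, v, rfl⟩ := exists_eq_toℂ_add p
  have hv : v = 0 := MvPolynomial.funext fun x => by
    simpa [eval_toℂ_real] using h x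
  exact ⟨u, by simp [hv, toℂ]⟩

end ComplexPolynomials

section SOS

variable {d m : ℕ} {F G : Matrix (Fin m) (Fin m) (MvPolynomial (Fin d) ℂ)}

lemma isSOSPoly_zero : IsSOSPoly (0 : Matrix (Fin m) (Fin m) (MvPolynomial (Fin d) ℂ)) :=
  ⟨0, 0, fun i j => by simp⟩

lemma IsSOSPoly.add (hF : IsSOSPoly F) (hG : IsSOSPoly G) : IsSOSPoly (F + G) := by
  obtain ⟨k, H, hH⟩ := hF
  obtain ⟨l, K, hK⟩ := hG
  refine ⟨k + l, fun i => Fin.append (H i) (K i), fun i j => ?_⟩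
  rw [Matrix.add_apply, hH, hK, Fin.sum_univ_add]
  simp

lemma IsSOSPoly.smul_mul_conjPoly (hF : IsSOSPoly F) (p : MvPolynomial (Fin d) ℂ) :
    IsSOSPoly ((p * conjPoly p) • F) := by
  obtain ⟨k, H, hH⟩ := hF
  refine ⟨k, fun i l => p * H i l, fun i j => ?_⟩
  rw [Matrix.smul_apply, hH, smul_eq_mul, Finset.mul_sum]
  refine Finset.sum_congr rfl fun l _ => ?_
  rw [conjPoly_mul]
  ring

lemma IsSOSPoly.toℂ_sq_smul (hF : IsSOSPoly F) (s : MvPolynomial (Fin d) ℝ) :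
    IsSOSPoly (toℂ s ^ 2 • F) := by
  simpa [conjPoly_toℂ, sq] using hF.smul_mul_conjPoly (toℂ s)

lemma IsSOSPoly.toℂ_smul (hF : IsSOSPoly F) {f : MvPolynomial (Fin d) ℝ} (hf : IsSumSq f) :
    IsSOSPoly (toℂ f • F) := by
  induction hf with
  | zero =>
    rw [show toℂ (0 : MvPolynomial (Fin d) ℝ) = 0 from map_zero _, zero_smul]
    exact isSOSPoly_zero
  | sq_add a hs ih =>
    rw [toℂ_add, add_smul, toℂ_mul, ← sq]
    exact (hF.toℂ_sq_smul a).add ih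

lemma isSOSPoly_vecMulVec (g : Fin m → MvPolynomial (Fin d) ℂ) :
    IsSOSPoly (Matrix.vecMulVec g fun j => conjPoly (g j)) :=
  ⟨1, fun i _ => g i, fun i j => by simp [Matrix.vecMulVec_apply]⟩

lemma isArtinDen_iff {s : MvPolynomial (Fin d) ℝ} :
    IsArtinDen F s ↔ s ≠ 0 ∧ IsSOSPoly (toℂ s ^ 2 • F) := Iff.rfl

end SOS

section MatrixArtin

lemma Matrix.PosSemidef.apply_eq_zero_of_diag {m : ℕ} {A : Matrix (Fin m) (Fin m) ℂ}
    (hA : A.PosSemidef) {i : Fin m} (hi : A i i = 0) (j : Fin m) : A i j = 0 := by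
  have h := (hA.submatrix ![i, j]).det_nonneg
  have hji : A j i = starRingEnd ℂ (A i j) := (hA.isHermitian.apply j i).symm
  rw [Matrix.det_fin_two] at h
  simp only [submatrix_apply, cons_val_zero, cons_val_one, hi, zero_mul, zero_sub, hji,
    Complex.mul_conj] at h
  have h' : 0 ≤ -Complex.normSq (A i j) := by exact_mod_cast h
  exact Complex.normSq_eq_zero.1 (le_antisymm (by linarith) (Complex.normSq_nonneg _))

lemma Matrix.PosSemidef.schur {m : ℕ} {A : Matrix (Fin m) (Fin m) ℂ} (hA : A.PosSemidef)
    (r : Fin m) :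
    (Matrix.of fun i j => A r r ^ 2 * A i j - A r r * (A i r * A r j)).PosSemidef := by
  let W : Matrix (Fin m) (Fin m) ℂ := A r r • 1 - vecMulVec (fun i => A i r) (Pi.single r 1)
  have hrr : starRingEnd ℂ (A r r) = A r r := hA.isHermitian.apply r r
  have hWA : W * A = Matrix.of fun i j => A r r * A i j - A i r * A r j := by
    ext i j
    simp [W, Matrix.sub_mul, vecMulVec_mul, vecMulVec_apply]
  convert hA.mul_mul_conjTranspose_same W using 1
  rw [hWA]
  ext i j
  have hst : star (fun i => A i r) j = A r j := hA.isHermitian.apply r j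
  simp only [W, conjTranspose_sub, conjTranspose_smul, conjTranspose_one,
    conjTranspose_vecMulVec, Matrix.mul_sub, mul_smul_comm, mul_one, mul_vecMulVec, sub_apply,
    smul_apply, vecMulVec_apply, of_apply, hst, smul_eq_mul]
  rw [← Pi.single_star, star_one]
  simp [hrr]
  ring

variable {d m : ℕ} {F : Matrix (Fin m) (Fin m) (MvPolynomial (Fin d) ℂ)}

lemma IsPSDPoly.conjPoly_apply (hF : IsPSDPoly F) (i j : Fin m) : conjPoly (F i j) = F j i :=
  MvPolynomial.eq_of_eval_real_eq fun x => by
    rw [eval_conjPoly_real]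
    exact (hF x).isHermitian.apply j i

lemma IsPSDPoly.apply_eq_zero_of_diag (hF : IsPSDPoly F) {i : Fin m} (hi : F i i = 0)
    (j : Fin m) : F i j = 0 :=
  MvPolynomial.eq_of_eval_real_eq fun x => by
    rw [map_zero]
    exact (hF x).apply_eq_zero_of_diag (i := i) (by simp [hi]) j

lemma IsPSDPoly.exists_diag_eq_toℂ (hF : IsPSDPoly F) (i : Fin m) :
    ∃ α, F i i = toℂ α ∧ ∀ x, 0 ≤ eval x α := by
  have hnn : ∀ x : Fin d → ℝ, 0 ≤ eval (fun t => (x t : ℂ)) (F i i) := fun x =>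
    (hF x).diag_nonneg
  obtain ⟨α, hα⟩ := exists_eq_toℂ_of_eval_real fun x => (Complex.nonneg_iff.1 (hnn x)).2.symm
  refine ⟨α, hα, fun x => ?_⟩
  have := hnn x
  rw [hα, eval_toℂ_real] at this
  exact_mod_cast this

/-- Artin's theorem for matrix polynomials. -/
theorem IsPSDPoly.exists_isArtinDen (hF : IsPSDPoly F) : ∃ s, IsArtinDen F s := by
  suffices key : ∀ (S : Finset (Fin m)) (F : Matrix (Fin m) (Fin m) (MvPolynomial (Fin d) ℂ)),
      IsPSDPoly F → (∀ i ∉ S, F i i = 0) → ∃ s, IsArtinDen F s from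
    key Finset.univ F hF fun i hi => absurd (Finset.mem_univ i) hi
  intro S
  induction S using Finset.induction_on with
  | empty =>
    intro F hF h0
    refine ⟨1, isArtinDen_iff.2 ⟨one_ne_zero, IsSOSPoly.toℂ_sq_smul ?_ _⟩⟩
    have : F = 0 := by
      ext1 i j
      exact hF.apply_eq_zero_of_diag (h0 i (by simp)) j
    exact this ▸ isSOSPoly_zero
  | insert r S hr ih =>
    intro F hF h0
    obtain ⟨α, hα, hα0⟩ := hF.exists_diag_eq_toℂ r
    by_cases hrr : α = 0
    · refine ih F hF fun i hi => ?_
      by_cases hir : i = r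
      · rw [hir, hα, hrr]
        exact map_zero _
      · exact h0 i (by simp [hir, hi])
    obtain ⟨q, hq0, hq⟩ := exists_sq_mul_isSumSq_of_nonneg hα0
    let G : Matrix (Fin m) (Fin m) (MvPolynomial (Fin d) ℂ) :=
      Matrix.of fun i j => toℂ α ^ 2 * F i j - toℂ α * (F i r * F r j)
    have hG : IsPSDPoly G := fun x => by
      convert (hF x).schur r using 1
      ext i j
      simp [G, hα]
    obtain ⟨s, hs⟩ := ih G hG fun i hi => by
      by_cases hir : i = r
      · subst hir
        simp only [G, of_apply, hα]
        ring
      · have hii := h0 i (by simp [hir, hi])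
        simp [G, hii, hF.apply_eq_zero_of_diag hii r]
    obtain ⟨hs0, hs⟩ := isArtinDen_iff.1 hs
    refine ⟨q * s * α, isArtinDen_iff.2 ⟨mul_ne_zero (mul_ne_zero hq0 hs0) hrr, ?_⟩⟩
    have hsum := (((isSOSPoly_vecMulVec fun i => F i r).toℂ_smul hq).toℂ_sq_smul s).add
      (hs.toℂ_sq_smul q)
    convert hsum using 1
    ext1 i j
    simp only [Matrix.add_apply, Matrix.smul_apply, smul_eq_mul, vecMulVec_apply, toℂ_mul,
      toℂ_pow, hF.conjPoly_apply, G, of_apply]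
    ring

end MatrixArtin

section MinimalDenominator

variable {d m : ℕ} {F : Matrix (Fin m) (Fin m) (MvPolynomial (Fin d) ℂ)}

lemma isSOSPoly_of_isArtinDen_C {c : ℝ} (h : IsArtinDen F (C c)) : IsSOSPoly F := by
  obtain ⟨h0, h⟩ := isArtinDen_iff.1 h
  have hc : c ≠ 0 := fun hc => h0 (by rw [hc, C_0])
  convert h.toℂ_sq_smul (C c⁻¹) using 1
  rw [smul_smul, ← mul_pow, ← toℂ_mul, ← C_mul, inv_mul_cancel₀ hc]
  simp [toℂ]

/-- A sign-changing irreducible factor can be removed from an Artin denominator. -/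
theorem isArtinDen_of_mul_of_sign_change {t u : MvPolynomial (Fin d) ℝ} (ht : Irreducible t)
    {x y : Fin d → ℝ} (hx : 0 < eval x t) (hy : eval y t < 0) (h : IsArtinDen F (t * u)) :
    IsArtinDen F u := by
  obtain ⟨h0, k, H, hH⟩ := h
  have hdvd : ∀ i l, toℂ t ∣ H i l := by
    intro i l
    choose a b hab using fun l => exists_eq_toℂ_add (H i l)
    have hsum : toℂ (∑ l, (a l ^ 2 + b l ^ 2)) = toℂ t ^ 2 * (toℂ u ^ 2 * F i i) := by
      have := hH i i
      rw [of_apply, toℂ_mul] at this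
      rw [← mul_assoc, ← mul_pow, this, toℂ, map_sum]
      refine Finset.sum_congr rfl fun l _ => ?_
      rw [hab l, mul_conjPoly_toℂ_add, toℂ]
    have hzero : ∀ w, eval w t = 0 → eval w (a l) = 0 ∧ eval w (b l) = 0 := by
      intro w hw
      have h1 := congrArg (eval fun j => (w j : ℂ)) hsum
      rw [map_mul, map_pow, eval_toℂ_real, eval_toℂ_real, hw, Complex.ofReal_zero,
        zero_pow two_ne_zero, zero_mul, Complex.ofReal_eq_zero, map_sum,
        Finset.sum_eq_zero_iff_of_nonneg fun l _ => by
          simpa using add_nonneg (sq_nonneg (eval w (a l))) (sq_nonneg (eval w (b l)))] at h1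
      have h2 := h1 l (Finset.mem_univ l)
      simp only [map_add, map_pow] at h2
      constructor <;> nlinarith [sq_nonneg (eval w (a l)), sq_nonneg (eval w (b l))]
    obtain ⟨a', ha'⟩ := dvd_of_sign_change ht hx hy fun w hw => (hzero w hw).1
    obtain ⟨b', hb'⟩ := dvd_of_sign_change ht hx hy fun w hw => (hzero w hw).2
    exact ⟨toℂ a' + C Complex.I * toℂ b', by rw [hab l, ha', hb', toℂ_mul, toℂ_mul]; ring⟩
  choose H' hH' using hdvd
  have ht0 : toℂ t ≠ 0 := fun h => ht.ne_zero (toℂ_injective (h.trans (map_zero _).symm))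
  refine ⟨right_ne_zero_of_mul h0, k, H', fun i j => ?_⟩
  refine mul_left_cancel₀ (pow_ne_zero 2 ht0) ?_
  have := hH i j
  rw [of_apply, toℂ_mul, mul_pow, mul_assoc] at this
  rw [of_apply, this, Finset.mul_sum]
  refine Finset.sum_congr rfl fun l _ => ?_
  rw [hH' i l, hH' j l, conjPoly_mul, conjPoly_toℂ]
  ring

end MinimalDenominator

/-- every PSD-not-SOS matrix polynomial has a non-constant minimal Artin
denominator, all of whose irreducible factors do not change sign on `ℝ^d`. -/
theorem artin_minimal_denominator (d m : ℕ)
    (F : Matrix (Fin m) (Fin m) (MvPolynomial (Fin d) ℂ))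
    (hPSD : IsPSDPoly F) (hnotSOS : ¬ IsSOSPoly F) :
    ∃ s : MvPolynomial (Fin d) ℝ,
      IsArtinDen F s ∧
      -- `s` is non-constant :
      0 < s.totalDegree ∧
      -- `s` is a minimal Artin denominator :
      (∀ t u : MvPolynomial (Fin d) ℝ, Irreducible t → s = t * u → ¬ IsArtinDen F u) ∧
      -- all irreducible factors of `s` do not change sign on `ℝ^d` :
      (∀ t : MvPolynomial (Fin d) ℝ, Irreducible t → t ∣ s →
        (∀ x : Fin d → ℝ, 0 ≤ eval x t) ∨ (∀ x : Fin d → ℝ, eval x t ≤ 0)) := by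
  obtain ⟨s, hs, hmin⟩ := exists_minimalFor_of_wellFoundedLT (IsArtinDen F)
    MvPolynomial.totalDegree hPSD.exists_isArtinDen
  have hminimal : ∀ t u : MvPolynomial (Fin d) ℝ, Irreducible t → s = t * u →
      ¬ IsArtinDen F u := by
    rintro t u ht rfl hu
    have hdeg := MvPolynomial.totalDegree_mul_of_isDomain ht.ne_zero hu.1
    have hpos : t.totalDegree ≠ 0 := fun h0 => by
      rw [MvPolynomial.totalDegree_eq_zero_iff_eq_C] at h0
      have hc : coeff 0 t ≠ 0 := fun hc => ht.ne_zero (by rw [h0, hc, C_0])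
      exact ht.not_isUnit (h0 ▸ hc.isUnit.map C)
    have := hmin hu (by omega)
    omega
  refine ⟨s, hs, Nat.pos_of_ne_zero fun h0 => ?_, hminimal, fun t ht hts => ?_⟩
  · rw [MvPolynomial.totalDegree_eq_zero_iff_eq_C] at h0
    exact hnotSOS (isSOSPoly_of_isArtinDen_C (h0 ▸ hs))
  · obtain ⟨u, rfl⟩ := hts
    by_contra! hsign
    obtain ⟨⟨y, hy⟩, x, hx⟩ := hsign
    exact hminimal t u ht rfl (isArtinDen_of_mul_of_sign_change ht hx hy hs)
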